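/- arXiv:2403.16519 — 5 statements merged into one kernel-verified Lean document; each statement's English description precedes it below -/
import Mathlib

section
/- Let k be a field of characteristic 0 with algebraic closure L, and let I ⊆ k[x_1,…,x_n] be a zero-dimensional ideal. For any t ∈ k[x_1,…,x_n], the characteristic polynomial χ_t of the multiplication map m_t factors over L as χ_t(T) = ∏_{p ∈ V_L(I)} (T − t(p))^{μ(p)}, where μ(p) is the multiplicity of p, i.e. the dimension over L of the localization of L[x_1,…,x_n]/(I·L[x_1,…,x_n]) at the maximal ideal corresponding to p. -/
set_option synthInstance.maxHeartbeats 1000000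
set_option maxHeartbeats 1000000

/-- The multiplicity `μ(p)` of a point `p ∈ V_L(I)`: the dimension over `L` of the
localization of `L[X]/(I·L[X])` at the maximal ideal corresponding to `p`. -/
noncomputable def multiplicityAt (k L : Type) [Field k] [Field L] [Algebra k L] {n : ℕ}
    (I : Ideal (MvPolynomial (Fin n) k)) (p : Fin n → L)
    (hp : ∀ f ∈ I, MvPolynomial.aeval p f = 0) : ℕ :=
  -- `J = I·L[X]`
  let J : Ideal (MvPolynomial (Fin n) L) := Ideal.map (MvPolynomial.map (algebraMap k L)) I
  -- evaluation at `p` on `L[X]/J`; its kernel is the maximal ideal corresponding to `p`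
  let φ : (MvPolynomial (Fin n) L ⧸ J) →+* L :=
    Ideal.Quotient.lift J (MvPolynomial.aeval p).toRingHom (by
      intro a ha
      have h : J ≤ RingHom.ker
          ((MvPolynomial.aeval p : MvPolynomial (Fin n) L →ₐ[L] L) : MvPolynomial (Fin n) L →+* L) := by
        rw [Ideal.map_le_iff_le_comap]
        intro f hf
        simp only [Ideal.mem_comap, RingHom.mem_ker, RingHom.coe_coe,
          MvPolynomial.aeval_map_algebraMap]
        exact hp f hf
      exact RingHom.mem_ker.mp (h ha))
  haveI : (RingHom.ker φ).IsPrime := RingHom.ker_isPrime φ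
  letI : Algebra L (Localization.AtPrime (RingHom.ker φ)) :=
    ((algebraMap (MvPolynomial (Fin n) L ⧸ J) (Localization.AtPrime (RingHom.ker φ))).comp
      (algebraMap L (MvPolynomial (Fin n) L ⧸ J))).toAlgebra
  Module.finrank L (Localization.AtPrime (RingHom.ker φ))

open scoped TensorProduct

lemma aux_charpoly_pi {K ι : Type} [Field K] [Fintype ι] (M : ι → Type)
    [∀ i, AddCommGroup (M i)] [∀ i, Module K (M i)] [∀ i, FiniteDimensional K (M i)]
    (f : ∀ i, M i →ₗ[K] M i) :
    (LinearMap.pi fun i => (f i).comp (LinearMap.proj i) : (∀ i, M i) →ₗ[K] (∀ i, M i)).charpoly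
      = ∏ i, (f i).charpoly := by
  classical
  let b := fun i => Module.Free.chooseBasis K (M i)
  letI : LinearOrder ι := LinearOrder.lift' (Fintype.equivFin ι) (Fintype.equivFin ι).injective
  have hM : LinearMap.toMatrix (Pi.basis b) (Pi.basis b)
      (LinearMap.pi fun i => (f i).comp (LinearMap.proj i)) =
      Matrix.blockDiagonal' (fun i => LinearMap.toMatrix (b i) (b i) (f i)) := by
    ext ⟨i, x⟩ ⟨j, y⟩
    rw [LinearMap.toMatrix_apply, Pi.basis_repr, Pi.basis_apply]
    simp only [LinearMap.pi_apply, LinearMap.comp_apply, LinearMap.proj_apply]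
    by_cases h : i = j
    · subst h
      simp [Matrix.blockDiagonal'_apply, LinearMap.toMatrix_apply]
    · simp [Matrix.blockDiagonal'_apply, h, Pi.single_eq_of_ne h]
  rw [← LinearMap.charpoly_toMatrix _ (Pi.basis b), hM]
  have ht := (Matrix.blockTriangular_blockDiagonal'
    (fun i => LinearMap.toMatrix (b i) (b i) (f i))).charmatrix
  rw [Matrix.charpoly, ht.det_fintype]
  refine Finset.prod_congr rfl fun i _ => ?_
  rw [← LinearMap.charpoly_toMatrix _ (b i), Matrix.charpoly]
  let e : Module.Free.ChooseBasisIndex K (M i) ≃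
      {s : Σ j, Module.Free.ChooseBasisIndex K (M j) // s.1 = i} :=
    (Equiv.sigmaSubtype (β := fun j => Module.Free.ChooseBasisIndex K (M j)) i).symm
  rw [← Matrix.det_submatrix_equiv_self e]
  congr 1
  ext1 x y
  have hx : ∀ x, (e x).1 = ⟨i, x⟩ := fun x => rfl
  simp only [Matrix.submatrix_apply, Matrix.toSquareBlock_def, Matrix.of_apply, hx]
  by_cases h : x = y
  · subst h
    simp [Matrix.charmatrix_apply_eq, Matrix.blockDiagonal'_apply]
  · rw [Matrix.charmatrix_apply_ne _ _ _ h, Matrix.charmatrix_apply_ne]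
    · simp [Matrix.blockDiagonal'_apply]
    · simpa using h

instance aux_finite_loc {K A : Type} [Field K] [CommRing A] [Algebra K A] [FiniteDimensional K A]
    (P : Ideal A) [P.IsPrime] : FiniteDimensional K (Localization.AtPrime P) := by
  haveI : IsArtinianRing A := IsArtinianRing.of_finite K A
  exact Module.Finite.of_surjective
    ((IsScalarTower.toAlgHom K A (Localization.AtPrime P)).toLinearMap)
    (IsArtinianRing.localization_surjective P.primeCompl _)

lemma aux_charpoly_prod {K A : Type} [Field K] [CommRing A] [Algebra K A] [FiniteDimensional K A]
    (a : A) :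
    (LinearMap.mulLeft K a).charpoly
      = ∏ᶠ m : MaximalSpectrum A,
        (LinearMap.mulLeft K (algebraMap A (Localization.AtPrime m.asIdeal) a)).charpoly := by
  haveI : IsArtinianRing A := IsArtinianRing.of_finite K A
  haveI := fun m : MaximalSpectrum A => aux_finite_loc (K := K) m.asIdeal
  letI : Fintype (MaximalSpectrum A) := Fintype.ofFinite _
  rw [finprod_eq_prod_of_fintype, ← aux_charpoly_pi]
  let e : A ≃ₗ[K] (∀ m : MaximalSpectrum A, Localization.AtPrime m.asIdeal) :=
    (MaximalSpectrum.toPiLocalizationEquiv A).toLinearEquiv.restrictScalars K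
  have he : ∀ x m, e x m = algebraMap A (Localization.AtPrime m.asIdeal) x := fun x m => rfl
  rw [← e.charpoly_conj]
  congr 1
  refine LinearMap.ext fun x => ?_
  obtain ⟨x, rfl⟩ := e.surjective x
  funext m
  simp [LinearEquiv.conj_apply, he]

lemma aux_local {K A : Type} [Field K] [CommRing A] [Algebra K A] [FiniteDimensional K A]
    (P : Ideal A) [P.IsPrime] (a : A) (c : K) (h : a - algebraMap K A c ∈ P) :
    (LinearMap.mulLeft K (algebraMap A (Localization.AtPrime P) a)).charpoly
      = (Polynomial.X - Polynomial.C c) ^ Module.finrank K (Localization.AtPrime P) := by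
  haveI := aux_finite_loc (K := K) P
  haveI : IsArtinianRing (Localization.AtPrime P) := IsArtinianRing.of_finite K _
  set R := Localization.AtPrime P
  have h1 : algebraMap A R (a - algebraMap K A c) ∈ IsLocalRing.maximalIdeal R :=
    (IsLocalization.AtPrime.to_map_mem_maximal_iff R P _).2 h
  have h2 : IsNilpotent (algebraMap A R (a - algebraMap K A c)) := by
    obtain ⟨n, hn⟩ := IsArtinianRing.isNilpotent_jacobson_bot (R := R)
    rw [IsLocalRing.jacobson_eq_maximalIdeal _ bot_ne_top] at hn
    exact ⟨n, by simpa [hn] using Ideal.pow_mem_pow h1 n⟩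
  have h3 : IsNilpotent (LinearMap.mulLeft K (algebraMap A R a) - c • 1) := by
    have : LinearMap.mulLeft K (algebraMap A R a) - c • 1
        = Algebra.lmul K R (algebraMap A R (a - algebraMap K A c)) := by
      ext x
      simp [sub_mul, ← IsScalarTower.algebraMap_apply K A R, Algebra.smul_def]
    rw [this]
    exact h2.map _
  have h4 := h3.charpoly_eq_X_pow_finrank
  rw [LinearMap.charpoly_sub_smul] at h4
  have := congrArg (fun q => q.comp (Polynomial.X - Polynomial.C c)) h4
  simpa [Polynomial.comp_assoc] using this

lemma aux_finrank {K A : Type} [Field K] [CommRing A] [Algebra K A]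
    (P Q : Ideal A) (hP : P.IsPrime) (hQ : Q.IsPrime) (h : P = Q) :
    Module.finrank K (Localization.AtPrime P) = Module.finrank K (Localization.AtPrime Q) := by
  subst h
  rfl

/-- Evaluation at a point on the quotient. -/
noncomputable def auxEval (k L : Type) [Field k] [Field L] [Algebra k L] {n : ℕ}
    (I : Ideal (MvPolynomial (Fin n) k)) (p : Fin n → L)
    (hp : ∀ f ∈ I, MvPolynomial.aeval p f = 0) :
    (MvPolynomial (Fin n) L ⧸ Ideal.map (MvPolynomial.map (algebraMap k L)) I) →ₐ[L] L :=
  Ideal.Quotient.liftₐ _ (MvPolynomial.aeval p) (by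
    intro a ha
    have h : Ideal.map (MvPolynomial.map (algebraMap k L)) I ≤ RingHom.ker
        ((MvPolynomial.aeval p : MvPolynomial (Fin n) L →ₐ[L] L) :
          MvPolynomial (Fin n) L →+* L) := by
      rw [Ideal.map_le_iff_le_comap]
      intro f hf
      simp only [Ideal.mem_comap, RingHom.mem_ker, RingHom.coe_coe,
        MvPolynomial.aeval_map_algebraMap]
      exact hp f hf
    exact RingHom.mem_ker.mp (h ha))

lemma auxEval_mk (k L : Type) [Field k] [Field L] [Algebra k L] {n : ℕ}
    (I : Ideal (MvPolynomial (Fin n) k)) (p : Fin n → L)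
    (hp : ∀ f ∈ I, MvPolynomial.aeval p f = 0) (g : MvPolynomial (Fin n) L) :
    auxEval k L I p hp (Ideal.Quotient.mk _ g) = MvPolynomial.aeval p g := rfl

/-- The maximal ideal of a point. -/
noncomputable def auxMax (k L : Type) [Field k] [Field L] [Algebra k L] {n : ℕ}
    (I : Ideal (MvPolynomial (Fin n) k))
    (p : {p : Fin n → L // ∀ f ∈ I, MvPolynomial.aeval p f = 0}) :
    MaximalSpectrum (MvPolynomial (Fin n) L ⧸ Ideal.map (MvPolynomial.map (algebraMap k L)) I) :=
  ⟨RingHom.ker (auxEval k L I p.1 p.2), RingHom.ker_isMaximal_of_surjective _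
    fun c => ⟨algebraMap _ _ c, by simp⟩⟩

lemma aux_mult (k L : Type) [Field k] [Field L] [Algebra k L] {n : ℕ}
    (I : Ideal (MvPolynomial (Fin n) k))
    (p : {p : Fin n → L // ∀ f ∈ I, MvPolynomial.aeval p f = 0}) :
    multiplicityAt k L I p.1 p.2 =
      Module.finrank L (Localization.AtPrime (auxMax k L I p).asIdeal) := by
  unfold multiplicityAt
  refine aux_finrank _ _ (RingHom.ker_isPrime _) _ ?_
  ext x
  obtain ⟨x, rfl⟩ := Ideal.Quotient.mk_surjective x
  rfl

lemma aux_bij (k L : Type) [Field k] [Field L] [Algebra k L] [IsAlgClosed L] {n : ℕ}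
    (I : Ideal (MvPolynomial (Fin n) k))
    [FiniteDimensional L
      (MvPolynomial (Fin n) L ⧸ Ideal.map (MvPolynomial.map (algebraMap k L)) I)] :
    Function.Bijective (auxMax k L I) := by
  constructor
  · intro p q h
    have h' : RingHom.ker (auxEval k L I p.1 p.2) = RingHom.ker (auxEval k L I q.1 q.2) :=
      congrArg MaximalSpectrum.asIdeal h
    ext i
    have h1 : Ideal.Quotient.mk _ (MvPolynomial.X i - MvPolynomial.C (p.1 i)) ∈
        RingHom.ker (auxEval k L I p.1 p.2) := by
      rw [RingHom.mem_ker, auxEval_mk]; simp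
    rw [h', RingHom.mem_ker, auxEval_mk] at h1
    simp [sub_eq_zero] at h1
    exact h1.symm
  · intro m
    set A := MvPolynomial (Fin n) L ⧸ Ideal.map (MvPolynomial.map (algebraMap k L)) I with hA
    haveI := m.isMaximal
    letI : Field (A ⧸ m.asIdeal) := Ideal.Quotient.field _
    haveI : FiniteDimensional L (A ⧸ m.asIdeal) := inferInstance
    have hb : Function.Bijective (algebraMap L (A ⧸ m.asIdeal)) :=
      IsAlgClosed.algebraMap_bijective_of_isIntegral
    let e := AlgEquiv.ofBijective (Algebra.ofId L (A ⧸ m.asIdeal)) hb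
    let ψ : A →ₐ[L] L := e.symm.toAlgHom.comp (Ideal.Quotient.mkₐ L m.asIdeal)
    let θ : MvPolynomial (Fin n) L →ₐ[L] L := ψ.comp (Ideal.Quotient.mkₐ L _)
    let p : Fin n → L := fun i => θ (MvPolynomial.X i)
    have hθ : θ = MvPolynomial.aeval p := MvPolynomial.algHom_ext (fun i => by simp [p])
    have hp : ∀ f ∈ I, MvPolynomial.aeval p f = 0 := by
      intro f hf
      rw [← MvPolynomial.aeval_map_algebraMap L, ← hθ]
      have : Ideal.Quotient.mk (Ideal.map (MvPolynomial.map (algebraMap k L)) I)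
          (MvPolynomial.map (algebraMap k L) f) = 0 :=
        Ideal.Quotient.eq_zero_iff_mem.2 (Ideal.mem_map_of_mem _ hf)
      change ψ (Ideal.Quotient.mk _ _) = 0
      rw [this, map_zero]
    refine ⟨⟨p, hp⟩, ?_⟩
    ext x
    change auxEval k L I p hp x = 0 ↔ _
    obtain ⟨x, rfl⟩ := Ideal.Quotient.mk_surjective x
    rw [auxEval_mk, ← hθ]
    change e.symm (Ideal.Quotient.mk m.asIdeal (Ideal.Quotient.mk _ x)) = 0 ↔ _
    rw [map_eq_zero_iff _ e.symm.injective, Ideal.Quotient.eq_zero_iff_mem]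

/-- Base change of the quotient. -/
lemma aux_equiv (k L : Type) [Field k] [Field L] [Algebra k L] {n : ℕ}
    (I : Ideal (MvPolynomial (Fin n) k)) :
    ∃ e : L ⊗[k] (MvPolynomial (Fin n) k ⧸ I) ≃ₐ[L]
      (MvPolynomial (Fin n) L ⧸ Ideal.map (MvPolynomial.map (algebraMap k L)) I),
      ∀ t, e (1 ⊗ₜ Ideal.Quotient.mk I t) =
        Ideal.Quotient.mk _ (MvPolynomial.map (algebraMap k L) t) := by
  let e1 := Algebra.TensorProduct.tensorQuotientEquiv (R := k) L (MvPolynomial (Fin n) k) L I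
  let e0 := MvPolynomial.algebraTensorAlgEquiv (σ := Fin n) k L
  have h : Ideal.map (MvPolynomial.map (algebraMap k L)) I =
      Ideal.map (e0 : _ →+* MvPolynomial (Fin n) L)
        (I.map (Algebra.TensorProduct.includeRight (A := L) (R := k))) := by
    have h2 : (MvPolynomial.map (algebraMap k L) : MvPolynomial (Fin n) k →+* _) =
        (e0 : _ →+* MvPolynomial (Fin n) L).comp
          (Algebra.TensorProduct.includeRight :
            MvPolynomial (Fin n) k →ₐ[k] L ⊗[k] MvPolynomial (Fin n) k).toRingHom := by
      refine RingHom.ext fun x => ?_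
      simp [e0]
    rw [h2, ← Ideal.map_map]
    rfl
  refine ⟨e1.trans (Ideal.quotientEquivAlg _ _ e0 h), fun t => ?_⟩
  change Ideal.Quotient.mk _ (e0 (1 ⊗ₜ t)) = _
  simp [e0]

lemma aux_finprod {α M : Type} [CommMonoid M] (P : α → Prop) (f : ∀ a, P a → M) :
    ∏ᶠ (a : α) (h : P a), f a h = ∏ᶠ x : {a // P a}, f x.1 x.2 := by
  classical
  have : ∀ a, ∏ᶠ (h : P a), f a h = ∏ᶠ (h : a ∈ {a | P a}), (if h : P a then f a h else 1) := by
    intro a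
    refine finprod_congr_Prop rfl fun h => ?_
    have h : P a := h
    simp [h]
  rw [finprod_congr this, ← finprod_set_coe_eq_finprod_mem]
  exact finprod_congr fun x => dif_pos x.2

/-- the characteristic polynomial of the multiplication map `m_t` factors over
`L` as `χ_t(T) = ∏_{p ∈ V_L(I)} (T − t(p))^{μ(p)}`. -/
theorem stmt_1 (k L : Type) [Field k] [CharZero k] [Field L] [Algebra k L]
    [IsAlgClosure k L] (n : ℕ) (I : Ideal (MvPolynomial (Fin n) k))
    [FiniteDimensional k (MvPolynomial (Fin n) k ⧸ I)]
    (t : MvPolynomial (Fin n) k) :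
    (LinearMap.charpoly (LinearMap.mulLeft k ((Ideal.Quotient.mk I) t))).map (algebraMap k L)
      = ∏ᶠ (p : Fin n → L) (hp : ∀ f ∈ I, MvPolynomial.aeval p f = 0),
          ((Polynomial.X : Polynomial L) - Polynomial.C (MvPolynomial.aeval p t))
            ^ multiplicityAt k L I p hp := by
  haveI : IsAlgClosed L := IsAlgClosure.isAlgClosed k
  obtain ⟨e, he⟩ := aux_equiv k L I
  haveI : FiniteDimensional L
      (MvPolynomial (Fin n) L ⧸ Ideal.map (MvPolynomial.map (algebraMap k L)) I) :=
    Module.Finite.equiv e.toLinearEquiv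
  rw [aux_finprod, ← LinearMap.charpoly_baseChange, ← e.toLinearEquiv.charpoly_conj]
  have h1 : e.toLinearEquiv.conj ((LinearMap.mulLeft k ((Ideal.Quotient.mk I) t)).baseChange L)
      = LinearMap.mulLeft L (Ideal.Quotient.mk _ (MvPolynomial.map (algebraMap k L) t)) := by
    have := Algebra.baseChange_lmul (R := k) (A := L) (Ideal.Quotient.mk I t)
    change (LinearMap.mulLeft k ((Ideal.Quotient.mk I) t)).baseChange L = _ at this
    rw [this]
    refine LinearMap.ext fun x => ?_
    simp [LinearEquiv.conj_apply, he]
  rw [h1, aux_charpoly_prod]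
  refine (finprod_eq_of_bijective (auxMax k L I) (aux_bij k L I) fun p => ?_).symm
  rw [aux_mult, aux_local _ _ (MvPolynomial.aeval p.1 t)]
  change auxEval k L I p.1 p.2 _ = 0
  rw [map_sub, auxEval_mk, AlgHom.commutes, MvPolynomial.aeval_map_algebraMap]
  exact sub_self _
end

section
/- Let k be a field of characteristic 0 with algebraic closure L, and let f_1,…,f_l ∈ k[U,X] with parameters U = (u_1,…,u_m) and variables X = (x_1,…,x_n). Then there exist finitely many pairs (E_1,N_1),…,(E_s,N_s) of finite subsets of k[U] such that for every ū ∈ L^m, the ideal I(ū) = ⟨f_1(ū,X),…,f_l(ū,X)⟩ of L[X] is zero-dimensional if and only if ū ∈ ⋃_{i=1}^{s} V_L(E_i)∖V_L(N_i). -/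
/-- The specialized ideal `I(u) = ⟨f_1(u,X),…,f_l(u,X)⟩ ⊆ L[X]` obtained from
`f_1,…,f_l ∈ k[U,X]` by substituting `u ∈ L^m` for the parameters `U`. -/
noncomputable def specIdeal (k L : Type) [Field k] [Field L] [Algebra k L]
    {m n l : ℕ} (f : Fin l → MvPolynomial (Fin m ⊕ Fin n) k) (u : Fin m → L) :
    Ideal (MvPolynomial (Fin n) L) :=
  Ideal.span (Set.range fun j : Fin l =>
    MvPolynomial.aeval (Sum.elim (fun i => MvPolynomial.C (u i)) MvPolynomial.X) (f j))

open Topology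

/-- Extending an `L`-point along a map of algebras, when its kernel is in the image of Spec. -/
theorem aux_extend {k L P B : Type} [Field k] [Field L] [Algebra k L] [IsAlgClosure k L]
    [CommRing P] [Algebra k P] [CommRing B] [Algebra k B] [Algebra.FiniteType k B]
    (φ : P →ₐ[k] B) (ev : P →ₐ[k] L) (q : Ideal B) (hq : q.IsPrime)
    (h : q.comap φ = RingHom.ker ev) : ∃ ψ : B →ₐ[k] L, ψ.comp φ = ev := by
  have : IsAlgClosed L := IsAlgClosure.isAlgClosed k
  have : Algebra.IsAlgebraic k L := IsAlgClosure.isAlgebraic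
  obtain ⟨M, hM, hqM⟩ := Ideal.exists_le_maximal q hq.ne_top
  have hmax : (RingHom.ker ev).IsMaximal := by
    have h1 : IsField ev.range :=
      Subalgebra.isField_of_algebraic ev.range
    have := (Ideal.quotientKerAlgEquivOfSurjective (ev.rangeRestrict_surjective)).toMulEquiv.isField
      h1
    have h2 : RingHom.ker ev.rangeRestrict = RingHom.ker ev := by
      ext x
      simp [RingHom.mem_ker, Subtype.ext_iff]
    rw [← h2]
    exact Ideal.Quotient.maximal_of_isField _ this
  have hMc : M.comap φ = RingHom.ker ev := by
    refine (hmax.eq_of_le ?_ ?_).symm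
    · exact (Ideal.comap_isPrime (K := M) φ).ne_top
    · rw [← h]; exact Ideal.comap_mono hqM
  let : Field (B ⧸ M) := Ideal.Quotient.field M
  let : Field (P ⧸ RingHom.ker ev) := Ideal.Quotient.field _
  have : Module.Finite k (B ⧸ M) := finite_of_finite_type_of_isJacobsonRing k (B ⧸ M)
  let α : (P ⧸ RingHom.ker ev) →ₐ[k] (B ⧸ M) :=
    Ideal.Quotient.liftₐ _ ((Ideal.Quotient.mkₐ k M).comp φ) (by
      intro a ha
      rw [← hMc] at ha
      exact Ideal.Quotient.eq_zero_iff_mem.mpr ha)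
  let β : (P ⧸ RingHom.ker ev) →ₐ[k] L :=
    Ideal.Quotient.liftₐ _ ev (fun a ha => ha)
  let : Algebra (P ⧸ RingHom.ker ev) (B ⧸ M) := α.toRingHom.toAlgebra
  let : Algebra (P ⧸ RingHom.ker ev) L := β.toRingHom.toAlgebra
  have : IsScalarTower k (P ⧸ RingHom.ker ev) (B ⧸ M) :=
    IsScalarTower.of_algebraMap_eq fun x => (α.commutes x).symm
  have : IsScalarTower k (P ⧸ RingHom.ker ev) L :=
    IsScalarTower.of_algebraMap_eq fun x => (β.commutes x).symm
  have : Algebra.IsAlgebraic (P ⧸ RingHom.ker ev) (B ⧸ M) :=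
    Algebra.IsAlgebraic.tower_top (K := k) _
  let σ : (B ⧸ M) →ₐ[P ⧸ RingHom.ker ev] L := IsAlgClosed.lift
  refine ⟨(σ.restrictScalars k).comp (Ideal.Quotient.mkₐ k M), ?_⟩
  ext x
  exact σ.commutes (Ideal.Quotient.mk _ x)

/-- Zero-dimensionality in terms of coordinate projections of the zero set. -/
theorem aux_fin {L : Type} [Field L] [IsAlgClosed L] {n : ℕ}
    (I : Ideal (MvPolynomial (Fin n) L)) :
    FiniteDimensional L (MvPolynomial (Fin n) L ⧸ I) ↔
      ∀ i : Fin n, {a : L | ∃ x ∈ MvPolynomial.zeroLocus L I, x i = a}.Finite := by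
  classical
  constructor
  · intro hfd i
    obtain ⟨p, hp, hp0⟩ := Algebra.IsIntegral.isIntegral (R := L)
      (Ideal.Quotient.mkₐ L I (MvPolynomial.X i))
    refine (p.roots.toFinset.finite_toSet).subset ?_
    rintro a ⟨x, hx, rfl⟩
    have h1 : Polynomial.aeval (MvPolynomial.X i : MvPolynomial (Fin n) L) p ∈ I := by
      rw [← Ideal.Quotient.eq_zero_iff_mem, ← Ideal.Quotient.mkₐ_eq_mk L,
        ← Polynomial.aeval_algHom_apply]
      exact hp0
    have h2 := hx _ h1
    rw [← Polynomial.aeval_algHom_apply] at h2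
    simpa [hp.ne_zero] using h2
  · intro h
    have hint : ∀ i, IsIntegral L (Ideal.Quotient.mkₐ L I (MvPolynomial.X i)) := by
      intro i
      let p : Polynomial L := ∏ a ∈ (h i).toFinset, (Polynomial.X - Polynomial.C a)
      have hp : p.Monic := Polynomial.monic_prod_X_sub_C _ _
      have h1 : Polynomial.aeval (MvPolynomial.X i : MvPolynomial (Fin n) L) p ∈ I.radical := by
        rw [← MvPolynomial.vanishingIdeal_zeroLocus_eq_radical (K := L)]
        intro x hx
        rw [← Polynomial.aeval_algHom_apply]
        simp only [MvPolynomial.aeval_X, p, map_prod]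
        refine Finset.prod_eq_zero (i := x i) ?_ (by simp)
        simpa using ⟨x, hx, rfl⟩
      obtain ⟨N, hN⟩ := h1
      refine ⟨p ^ N, hp.pow N, ?_⟩
      rw [← map_pow, ← Ideal.Quotient.eq_zero_iff_mem, ← Ideal.Quotient.mkₐ_eq_mk L,
        ← Polynomial.aeval_algHom_apply] at hN
      exact hN
    have hfin := Algebra.finite_adjoin_of_finite_of_isIntegral (R := L)
      (s := Set.range fun i => Ideal.Quotient.mkₐ L I (MvPolynomial.X i)) (Set.finite_range _)
      (by rintro _ ⟨i, rfl⟩; exact hint i)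
    have htop : Algebra.adjoin L (Set.range fun i => Ideal.Quotient.mkₐ L I (MvPolynomial.X i))
        = ⊤ := by
      have := congrArg (Subalgebra.map (Ideal.Quotient.mkₐ L I))
        (MvPolynomial.adjoin_range_X (R := L) (σ := Fin n))
      rw [AlgHom.map_adjoin, ← Set.range_comp, Algebra.map_top,
        (AlgHom.range_eq_top _).mpr (Ideal.Quotient.mkₐ_surjective L I)] at this
      exact this
    rw [htop] at hfin
    exact Module.Finite.equiv (Subalgebra.topEquiv (R := L)).toLinearEquiv

/-- The prime of `k[U]` attached to a point. -/
noncomputable def auxPt {k L R : Type} [Field k] [Field L] [Algebra k L] [CommRing R]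
    [Algebra k R] (e : R →ₐ[k] L) : PrimeSpectrum R :=
  ⟨RingHom.ker e, RingHom.ker_isPrime _⟩

/-- Fibres of a basic constructible subset of the line. -/
theorem aux_line {L ι : Type} [Field L] [Infinite L] (g : ι → Polynomial L) (f : Polynomial L) :
    {a : L | (∀ j, (g j).eval a = 0) ∧ f.eval a ≠ 0}.Infinite ↔ (∀ j, g j = 0) ∧ f ≠ 0 := by
  constructor
  · intro h
    refine ⟨fun j => ?_, ?_⟩
    · exact Polynomial.eq_zero_of_infinite_isRoot _ (h.mono fun a ha => ha.1 j)
    · rintro rfl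
      simp at h
  · rintro ⟨hg, hf⟩
    have : {a : L | (∀ j, (g j).eval a = 0) ∧ f.eval a ≠ 0} = {a | f.IsRoot a}ᶜ := by
      ext a; simp [hg]
    rw [this]
    exact (Polynomial.finite_setOfPred_isRoot hf).infinite_compl

/-- The locus where the `i`-th coordinate projection is infinite is constructible. -/
theorem aux_coord (k L : Type) [Field k] [Field L] [Algebra k L]
    [IsAlgClosure k L] (m n l : ℕ) (f : Fin l → MvPolynomial (Fin m ⊕ Fin n) k) (i : Fin n) :
    ∃ T : Set (PrimeSpectrum (MvPolynomial (Fin m) k)), IsConstructible T ∧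
      ∀ u : Fin m → L, auxPt (MvPolynomial.aeval (R := k) u) ∈ T ↔
        {a : L | ∃ x ∈ MvPolynomial.zeroLocus L (specIdeal k L f u), x i = a}.Infinite := by
  classical
  have : IsAlgClosed L := IsAlgClosure.isAlgClosed k
  have : Infinite L := IsAlgClosed.instInfinite
  let A := MvPolynomial (Fin m) k
  let J : Ideal (MvPolynomial (Fin m ⊕ Fin n) k) := Ideal.span (Set.range f)
  let B := MvPolynomial (Fin m ⊕ Fin n) k ⧸ J
  let φ : Polynomial A →ₐ[k] B := (Ideal.Quotient.mkₐ k J).comp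
    (Polynomial.eval₂AlgHom (MvPolynomial.rename Sum.inl) (MvPolynomial.X (Sum.inr i))
      (fun _ => Commute.all _ _))
  have hfp : φ.toRingHom.FinitePresentation := by
    rw [← RingHom.FinitePresentation.of_finiteType]
    have h1 : (φ.toRingHom.comp (algebraMap k (Polynomial A))).FiniteType := by
      have : φ.toRingHom.comp (algebraMap k (Polynomial A)) = algebraMap k B :=
        φ.comp_algebraMap
      rw [this, RingHom.finiteType_algebraMap]
      infer_instance
    exact RingHom.FiniteType.of_comp_finiteType h1
  obtain ⟨S, hS⟩ := PrimeSpectrum.exists_constructibleSetData_iff.mpr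
    (PrimeSpectrum.isConstructible_range_comap hfp)
  let ev : (Fin m → L) → L → Polynomial A →ₐ[k] L := fun u a =>
    Polynomial.eval₂AlgHom (MvPolynomial.aeval u) a (fun _ => Commute.all _ _)
  -- membership of points in the image
  have key : ∀ u a, auxPt (ev u a) ∈ S.toSet ↔
      ∃ x ∈ MvPolynomial.zeroLocus L (specIdeal k L f u), x i = a := by
    intro u a
    rw [hS]
    have hcomp : ∀ (x : Fin n → L) (p : MvPolynomial (Fin m ⊕ Fin n) k),
        MvPolynomial.aeval x (MvPolynomial.aeval (R := k)
          (Sum.elim (fun i => MvPolynomial.C (u i)) MvPolynomial.X : _ → MvPolynomial (Fin n) L) p)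
          = MvPolynomial.aeval (Sum.elim u x) p := by
      intro x p
      have : (((MvPolynomial.aeval x : MvPolynomial (Fin n) L →ₐ[L] L).restrictScalars k).comp
        (MvPolynomial.aeval (R := k)
          (Sum.elim (fun i => MvPolynomial.C (u i)) MvPolynomial.X : _ → MvPolynomial (Fin n) L)))
          = MvPolynomial.aeval (Sum.elim u x) := by
        ext s
        rcases s with s | s <;> simp
      exact congrArg (fun g => g p) this
    have hz : ∀ x : Fin n → L, x ∈ MvPolynomial.zeroLocus L (specIdeal k L f u) ↔
        ∀ j, MvPolynomial.aeval (Sum.elim u x) (f j) = 0 := by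
      intro x
      rw [specIdeal, MvPolynomial.zeroLocus_span]
      constructor
      · intro h j
        rw [← hcomp]
        exact h _ ⟨j, rfl⟩
      · rintro h _ ⟨j, rfl⟩
        rw [hcomp]
        exact h j
    constructor
    · rintro ⟨q, hq⟩
      obtain ⟨ψ, hψ⟩ := aux_extend φ (ev u a) q.asIdeal q.isPrime
        (congrArg PrimeSpectrum.asIdeal hq)
      let χ := ψ.comp (Ideal.Quotient.mkₐ k J)
      refine ⟨fun s => χ (MvPolynomial.X (Sum.inr s)), ?_, ?_⟩
      · rw [hz]
        intro j
        have hu : ∀ s, χ (MvPolynomial.X (Sum.inl s)) = u s := by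
          intro s
          have h2 : φ (Polynomial.C (MvPolynomial.X s)) =
              Ideal.Quotient.mkₐ k J (MvPolynomial.X (Sum.inl s)) := by
            refine congrArg (Ideal.Quotient.mkₐ k J) ?_
            exact (Polynomial.eval₂_C _ _).trans (MvPolynomial.rename_X _ _)
          have h3 : ev u a (Polynomial.C (MvPolynomial.X s)) = u s :=
            (Polynomial.eval₂_C _ _).trans (MvPolynomial.aeval_X _ _)
          rw [← h3, ← hψ]
          exact congrArg ψ h2.symm
        have : χ = MvPolynomial.aeval (Sum.elim u fun s => χ (MvPolynomial.X (Sum.inr s))) := by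
          ext s
          rcases s with s | s <;> simp [hu]
        rw [← this]
        have h0 : Ideal.Quotient.mkₐ k J (f j) = 0 :=
          Ideal.Quotient.eq_zero_iff_mem.mpr (Ideal.subset_span ⟨j, rfl⟩)
        simp only [χ, AlgHom.comp_apply, h0, map_zero]
      · have h2 : φ Polynomial.X = Ideal.Quotient.mkₐ k J (MvPolynomial.X (Sum.inr i)) :=
          congrArg (Ideal.Quotient.mkₐ k J) (Polynomial.eval₂_X _ _)
        have h3 : ev u a Polynomial.X = a := Polynomial.eval₂_X _ _
        refine Eq.trans ?_ h3
        rw [← hψ]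
        exact congrArg ψ h2.symm
    · rintro ⟨x, hx, rfl⟩
      rw [hz] at hx
      let ψ : B →ₐ[k] L := Ideal.Quotient.liftₐ J (MvPolynomial.aeval (Sum.elim u x)) (by
        intro p hp
        have : J ≤ RingHom.ker (MvPolynomial.aeval (R := k) (Sum.elim u x)) := by
          rw [Ideal.span_le]
          rintro _ ⟨j, rfl⟩
          exact hx j
        exact this hp)
      have hψ : ψ.comp φ = ev u (x i) := by
        apply Polynomial.algHom_ext'
        · apply MvPolynomial.algHom_ext
          intro s
          have h2 : φ (Polynomial.C (MvPolynomial.X s)) =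
              Ideal.Quotient.mkₐ k J (MvPolynomial.X (Sum.inl s)) := by
            refine congrArg (Ideal.Quotient.mkₐ k J) ?_
            exact (Polynomial.eval₂_C _ _).trans (MvPolynomial.rename_X _ _)
          have h3 : ev u (x i) (Polynomial.C (MvPolynomial.X s)) = u s :=
            (Polynomial.eval₂_C _ _).trans (MvPolynomial.aeval_X _ _)
          refine Eq.trans ?_ h3.symm
          refine (congrArg ψ h2).trans ?_
          exact MvPolynomial.aeval_X (R := k) (Sum.elim u x) (Sum.inl s)
        · have h2 : φ Polynomial.X = Ideal.Quotient.mkₐ k J (MvPolynomial.X (Sum.inr i)) :=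
            congrArg (Ideal.Quotient.mkₐ k J) (Polynomial.eval₂_X _ _)
          have h3 : ev u (x i) Polynomial.X = x i := Polynomial.eval₂_X _ _
          refine Eq.trans ?_ h3.symm
          refine (congrArg ψ h2).trans ?_
          exact MvPolynomial.aeval_X (R := k) (Sum.elim u x) (Sum.inr i)
      refine ⟨auxPt ψ, ?_⟩
      rw [← hψ]
      rfl
  have hev : ∀ u a (p : Polynomial A),
      ev u a p = (p.map (MvPolynomial.aeval (R := k) u).toRingHom).eval a := by
    intro u a p
    rw [Polynomial.eval_map]
    rfl
  refine ⟨⋃ C ∈ S, (PrimeSpectrum.zeroLocus (⋃ j, ((C.g j).coeffs : Set A)) \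
    PrimeSpectrum.zeroLocus (C.f.coeffs : Set A)), ?_, ?_⟩
  · have hcl : ∀ s : Set A, s.Finite → IsConstructible (PrimeSpectrum.zeroLocus s) := by
      intro s hs
      rw [← isConstructible_compl]
      exact (PrimeSpectrum.isRetrocompact_zeroLocus_compl hs).isConstructible
        (PrimeSpectrum.isClosed_zeroLocus _).isOpen_compl
    refine .biUnion S.finite_toSet fun C _ => .sdiff (hcl _ ?_) (hcl _ ?_)
    · exact Set.finite_iUnion fun j => Finset.finite_toSet _
    · exact Finset.finite_toSet _
  · intro u
    have hset : {a : L | ∃ x ∈ MvPolynomial.zeroLocus L (specIdeal k L f u), x i = a} =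
        ⋃ C ∈ S, {a : L | (∀ j, ((C.g j).map (MvPolynomial.aeval (R := k) u).toRingHom).eval a = 0)
          ∧ (C.f.map (MvPolynomial.aeval (R := k) u).toRingHom).eval a ≠ 0} := by
      ext a
      rw [Set.mem_ofPred_eq, ← key]
      simp only [PrimeSpectrum.ConstructibleSetData.toSet, Set.mem_iUnion, Set.mem_ofPred_eq,
        PrimeSpectrum.BasicConstructibleSetData.toSet, Set.mem_sdiff, PrimeSpectrum.mem_zeroLocus,
        Set.range_subset_iff, Set.singleton_subset_iff, ← hev]
      rfl
    have hmap0 : ∀ p : Polynomial A, p.map (MvPolynomial.aeval (R := k) u).toRingHom = 0 ↔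
        (p.coeffs : Set A) ⊆ (auxPt (MvPolynomial.aeval (R := k) u)).asIdeal := by
      intro p
      constructor
      · intro h c hc
        obtain ⟨N, -, rfl⟩ := Polynomial.mem_coeffs_iff.mp hc
        have := congrArg (fun r => r.coeff N) h
        simp only [Polynomial.coeff_map, Polynomial.coeff_zero] at this
        exact this
      · intro h
        ext N
        rw [Polynomial.coeff_map, Polynomial.coeff_zero]
        by_cases h0 : p.coeff N = 0
        · rw [h0, map_zero]
        · exact h (Polynomial.coeff_mem_coeffs h0)
    rw [hset]
    have hinf : ∀ (F : PrimeSpectrum.BasicConstructibleSetData (Polynomial A) → Set L),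
        (⋃ C ∈ S, F C).Infinite ↔ ∃ C ∈ S, (F C).Infinite := by
      intro F
      rw [← not_iff_not]
      push Not
      constructor
      · intro h C hC
        exact h.subset (Set.subset_biUnion_of_mem (u := F) hC)
      · intro h
        exact S.finite_toSet.biUnion h
    rw [hinf]
    simp only [aux_line, Set.mem_iUnion, Set.mem_sdiff, PrimeSpectrum.mem_zeroLocus,
      Set.iUnion_subset_iff, hmap0, exists_prop, ne_eq]

/-- for `f_1,…,f_l ∈ k[U,X]` there are finitely many pairs `(E_i, N_i)` of
finite subsets of `k[U]` such that for every `u ∈ L^m`, the specialized ideal `I(u)` is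
zero-dimensional iff `u ∈ ⋃ᵢ V_L(E_i)∖V_L(N_i)`. -/
theorem stmt_9 (k L : Type) [Field k] [CharZero k] [Field L] [Algebra k L]
    [IsAlgClosure k L] (m n l : ℕ) (f : Fin l → MvPolynomial (Fin m ⊕ Fin n) k) :
    ∃ (s : ℕ) (Es Ns : Fin s → Finset (MvPolynomial (Fin m) k)),
      ∀ u : Fin m → L,
        FiniteDimensional L (MvPolynomial (Fin n) L ⧸ specIdeal k L f u)
          ↔ ∃ i : Fin s, (∀ g ∈ Es i, MvPolynomial.aeval u g = 0) ∧
              (∃ g ∈ Ns i, MvPolynomial.aeval u g ≠ 0) := by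
  classical
  have : IsAlgClosed L := IsAlgClosure.isAlgClosed k
  choose T hT hTu using aux_coord k L m n l f
  obtain ⟨S, hS⟩ := PrimeSpectrum.exists_constructibleSetData_iff.mpr
    (IsConstructible.iUnion hT).compl
  refine ⟨S.card, fun i => Finset.univ.image (S.equivFin.symm i).1.g,
    fun i => {(S.equivFin.symm i).1.f}, fun u => ?_⟩
  rw [aux_fin]
  have h1 : (∀ i : Fin n,
      {a : L | ∃ x ∈ MvPolynomial.zeroLocus L (specIdeal k L f u), x i = a}.Finite) ↔
      auxPt (MvPolynomial.aeval (R := k) u) ∈ S.toSet := by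
    rw [hS]
    simp only [Set.mem_compl_iff, Set.mem_iUnion, hTu, not_exists, Set.not_infinite]
  rw [h1]
  simp only [PrimeSpectrum.ConstructibleSetData.toSet, Set.mem_iUnion,
    PrimeSpectrum.BasicConstructibleSetData.toSet, Set.mem_sdiff, PrimeSpectrum.mem_zeroLocus,
    Set.range_subset_iff, Set.singleton_subset_iff]
  constructor
  · rintro ⟨C, hC, hg, hf⟩
    refine ⟨S.equivFin ⟨C, hC⟩, ?_, ?_⟩
    · rw [Equiv.symm_apply_apply]
      intro g hg'
      obtain ⟨j, -, rfl⟩ := Finset.mem_image.mp hg'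
      exact hg j
    · rw [Equiv.symm_apply_apply]
      exact ⟨C.f, Finset.mem_singleton_self _, hf⟩
  · rintro ⟨i, hg, g, hgm, hgn⟩
    refine ⟨_, (S.equivFin.symm i).2, fun j => ?_, ?_⟩
    · exact hg _ (Finset.mem_image_of_mem _ (Finset.mem_univ j))
    · rw [Finset.mem_singleton.mp hgm] at hgn
      exact hgn
end

section
/- Let k be a field of characteristic 0 with algebraic closure L, let f_1,…,f_l ∈ k[U,X], let t ∈ k[X], and let E, N be finite subsets of k[U] such that for all ū ∈ V_L(E)∖V_L(N): I(ū) is zero-dimensional and the number of points of V_L(I(ū)) equals a fixed integer k_0 ≥ 2. Suppose 𝒳 ∈ k[U][T] is a polynomial whose leading coefficient in T does not vanish on V_L(E)∖V_L(N) and such that for every ū ∈ V_L(E)∖V_L(N), 𝒳(ū,T) is a nonzero scalar multiple in L[T] of the characteristic polynomial of the multiplication map by t on L[X]/I(ū). Then there exists a polynomial p ∈ k[U] such that for every ū ∈ V_L(E)∖V_L(N): t separates V_L(I(ū)) if and only if p(ū) ≠ 0. -/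
open Polynomial in
theorem hankel_aux {K : Type} [Field K] [CharZero K] [DecidableEq K] (d k₀ : ℕ) (y : Fin d → K)
    (h : (Finset.univ.image y).card ≤ k₀) :
    (Matrix.of fun i j : Fin k₀ => ∑ r, y r ^ ((i : ℕ) + (j : ℕ))).det ≠ 0 ↔
      (Finset.univ.image y).card = k₀ := by
  constructor
  · intro hdet
    by_contra hne
    have hlt : (Finset.univ.image y).card < k₀ := lt_of_le_of_ne h hne
    apply hdet
    rw [← Matrix.exists_mulVec_eq_zero_iff]
    set q : K[X] := ∏ s ∈ Finset.univ.image y, (X - C s) with hq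
    have hmon : q.Monic := monic_prod_of_monic _ _ fun s _ => monic_X_sub_C s
    have hdeg : q.natDegree = (Finset.univ.image y).card := by
      rw [hq, natDegree_prod_of_monic _ _ fun s _ => monic_X_sub_C s]
      simp
    refine ⟨fun j => q.coeff j, ?_, ?_⟩
    · intro h0
      have := congrFun h0 ⟨_, hlt⟩
      simp only [Pi.zero_apply] at this
      rw [← hdeg] at this
      exact one_ne_zero (hmon.coeff_natDegree.symm.trans this)
    · ext i
      simp only [Matrix.mulVec, dotProduct, Matrix.of_apply, Pi.zero_apply, Finset.sum_mul]
      rw [Finset.sum_comm]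
      apply Finset.sum_eq_zero
      intro r _
      have hr : q.eval (y r) = 0 := by
        rw [hq, eval_prod]
        exact Finset.prod_eq_zero (Finset.mem_image_of_mem y (Finset.mem_univ r)) (by simp)
      rw [eval_eq_sum_range' (n := k₀) (by omega), ← Fin.sum_univ_eq_sum_range
        (fun j => q.coeff j * y r ^ j)] at hr
      calc _ = y r ^ (i : ℕ) * ∑ j : Fin k₀, q.coeff j * y r ^ (j : ℕ) := by
            rw [Finset.mul_sum]
            exact Finset.sum_congr rfl fun j _ => by ring
        _ = 0 := by rw [hr, mul_zero]
  · intro hc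
    let e : Fin k₀ ≃ (Finset.univ.image y) := (Finset.equivFinOfCardEq hc).symm
    let z : Fin k₀ → K := fun i => (e i : K)
    have hz : Function.Injective z := Subtype.val_injective.comp e.injective
    let c : Fin k₀ → K := fun s => ((Finset.univ.filter fun r => y r = z s).card : K)
    have hH : (Matrix.of fun i j : Fin k₀ => ∑ r, y r ^ ((i : ℕ) + (j : ℕ))) =
        (Matrix.vandermonde z).transpose * Matrix.diagonal c * Matrix.vandermonde z := by
      ext i j
      rw [Matrix.mul_apply]
      simp only [Matrix.of_apply, Matrix.mul_diagonal, Matrix.transpose_apply,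
        Matrix.vandermonde_apply]
      have h1 : ∑ r, y r ^ ((i : ℕ) + (j : ℕ)) =
          ∑ s ∈ Finset.univ.image y, (Finset.univ.filter fun r => y r = s).card •
            s ^ ((i : ℕ) + (j : ℕ)) :=
        Finset.sum_comp (fun s : K => s ^ ((i : ℕ) + (j : ℕ))) y
      rw [h1, ← Finset.sum_coe_sort, ← e.sum_comp]
      refine Finset.sum_congr rfl fun s _ => ?_
      simp only [nsmul_eq_mul, c, z, pow_add]
      ring
    rw [hH, Matrix.det_mul, Matrix.det_mul, Matrix.det_transpose, Matrix.det_diagonal]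
    have hV := Matrix.det_vandermonde_ne_zero_iff.2 hz
    refine mul_ne_zero (mul_ne_zero hV (Finset.prod_ne_zero_iff.2 fun s _ => ?_)) hV
    obtain ⟨r, _, hr⟩ := Finset.mem_image.1 (e s).2
    simp only [c]
    rw [Nat.cast_ne_zero]
    exact Finset.card_ne_zero_of_mem (Finset.mem_filter.2 ⟨Finset.mem_univ r, hr⟩)

open Polynomial in
theorem psum_aux {R : Type} [CommRing R] (G : R[X]) (d j : ℕ) :
    ∃ s : R, ∀ (K : Type) [Field K] (φ : R →+* K) (y : Fin d → K),
      G.map φ = ∏ i, (X - C (y i)) → φ s = ∑ i, y i ^ j := by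
  obtain ⟨P, hP⟩ := MvPolynomial.esymmAlgHom_fin_surjective ℤ (le_refl d)
    ⟨MvPolynomial.psum (Fin d) ℤ j, MvPolynomial.psum_isSymmetric _ _ _⟩
  have hP' := congrArg Subtype.val hP
  rw [MvPolynomial.esymmAlgHom_apply] at hP'
  refine ⟨MvPolynomial.aeval (fun i : Fin d => (-1) ^ ((i : ℕ) + 1) * G.coeff (d - (i + 1))) P, ?_⟩
  intro K _ φ y hG
  have h2 := congrArg (MvPolynomial.aeval y) hP'
  simp only [MvPolynomial.psum, map_sum, map_pow, MvPolynomial.aeval_X] at h2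
  rw [← h2]
  change φ.toIntAlgHom _ = _
  rw [← AlgHom.comp_apply, ← AlgHom.comp_apply, MvPolynomial.comp_aeval, MvPolynomial.comp_aeval]
  congr 2
  funext i
  rw [MvPolynomial.aeval_esymm_eq_multiset_esymm]
  have hc : φ (G.coeff (d - (i + 1))) = (-1) ^ ((i : ℕ) + 1) *
      (Multiset.map y Finset.univ.val).esymm (i + 1) := by
    rw [← coeff_map, hG]
    have := Multiset.prod_X_sub_C_coeff (Multiset.map y Finset.univ.val) (k := d - (i + 1))
      (by simp)
    simp only [Multiset.map_map, Multiset.card_map, Finset.card_val, Finset.card_univ,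
      Fintype.card_fin, Function.comp_def] at this
    have h3 : d - (d - ((i : ℕ) + 1)) = i + 1 := by omega
    rw [h3] at this
    exact this
  change φ _ = _
  rw [map_mul, hc, map_pow, map_neg, map_one, ← mul_assoc, ← mul_pow]
  simp

/-- roots of the characteristic polynomial = values on the zero set -/
theorem roots_aux {L : Type} [Field L] [IsAlgClosed L] {n : ℕ} (I : Ideal (MvPolynomial (Fin n) L))
    [FiniteDimensional L (MvPolynomial (Fin n) L ⧸ I)] (t : MvPolynomial (Fin n) L) (x : L) :
    (LinearMap.charpoly (LinearMap.mulLeft L (Ideal.Quotient.mk I t))).IsRoot x ↔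
      ∃ q : Fin n → L, (∀ g ∈ I, MvPolynomial.aeval q g = 0) ∧ MvPolynomial.aeval q t = x := by
  rw [← Module.End.hasEigenvalue_iff_isRoot_charpoly]
  constructor
  · intro h
    obtain ⟨v, hv⟩ := h.exists_hasEigenvector
    have hv1 : Ideal.Quotient.mk I t * v = x • v := hv.apply_eq_smul
    have hJ : I ⊔ Ideal.span {t - MvPolynomial.C x} ≠ ⊤ := by
      intro htop
      rw [Ideal.eq_top_iff_one, Submodule.mem_sup] at htop
      obtain ⟨a, ha, b, hb, hab⟩ := htop
      obtain ⟨w, rfl⟩ := Ideal.mem_span_singleton'.1 hb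
      apply hv.2
      have h1 : (1 : MvPolynomial (Fin n) L ⧸ I) =
          Ideal.Quotient.mk I w * (Ideal.Quotient.mk I t - Ideal.Quotient.mk I (MvPolynomial.C x)) := by
        rw [← map_sub, ← map_mul, ← map_one (Ideal.Quotient.mk I), ← hab, map_add,
          Ideal.Quotient.eq_zero_iff_mem.2 ha, zero_add]
      have h2 : Ideal.Quotient.mk I (MvPolynomial.C x) * v = x • v := by
        obtain ⟨v, rfl⟩ := Ideal.Quotient.mk_surjective v
        rw [← map_mul, MvPolynomial.C_mul']; rfl
      rw [← one_mul v, h1, mul_assoc, sub_mul, hv1, h2, sub_self, mul_zero]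
    obtain ⟨M, hM, hIM⟩ := Ideal.exists_le_maximal _ hJ
    obtain ⟨q, rfl⟩ := MvPolynomial.isMaximal_iff_eq_vanishingIdeal_singleton.1 hM
    refine ⟨q, fun g hg => ?_, ?_⟩
    · exact (MvPolynomial.mem_vanishingIdeal_singleton_iff q g).1 (hIM (Ideal.mem_sup_left hg))
    · have := (MvPolynomial.mem_vanishingIdeal_singleton_iff q _).1
        (hIM (Ideal.mem_sup_right (Ideal.mem_span_singleton_self _)))
      simpa [sub_eq_zero] using this
  · rintro ⟨q, hq, rfl⟩
    rw [Module.End.hasEigenvalue_iff_mem_spectrum, spectrum.mem_iff]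
    intro hu
    set x := MvPolynomial.aeval q t
    have hb := (Module.End.isUnit_iff _).1 hu
    obtain ⟨w, hw⟩ := hb.2 1
    obtain ⟨w, rfl⟩ := Ideal.Quotient.mk_surjective w
    have h2 : Ideal.Quotient.mk I ((MvPolynomial.C x - t) * w - 1) = 0 := by
      rw [map_sub, map_mul, map_sub, map_one, ← hw, sub_mul, sub_eq_zero]
      simp only [LinearMap.sub_apply, Module.algebraMap_end_apply, LinearMap.mulLeft_apply]
      rw [← map_mul, MvPolynomial.C_mul']; rfl
    have h3 := hq _ (Ideal.Quotient.eq_zero_iff_mem.1 h2)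
    simp [x] at h3

open Polynomial in
/-- The polynomial detecting the number of distinct roots. -/
theorem detect_aux {R : Type} [CommRing R] [IsDomain R] (F : R[X]) (k₀ : ℕ) (hF : 1 ≤ F.natDegree) :
    ∃ p : R, ∀ (K : Type) [Field K] [CharZero K] [IsAlgClosed K] (φ : R →+* K),
      φ F.leadingCoeff ≠ 0 → {x | (F.map φ).IsRoot x}.ncard ≤ k₀ →
      ({x | (F.map φ).IsRoot x}.ncard = k₀ ↔ φ p ≠ 0) := by
  classical
  choose s hs using psum_aux F.integralNormalization F.natDegree
  refine ⟨(Matrix.of fun i j : Fin k₀ => s ((i : ℕ) + (j : ℕ))).det, ?_⟩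
  intro K _ _ _ φ ha hle
  have hF0 : F ≠ 0 := by rintro rfl; simp at hF
  set a := φ F.leadingCoeff with ha'
  set G := F.integralNormalization.map φ with hG
  have hGm : G.Monic := (monic_integralNormalization hF0).map φ
  have hGd : G.natDegree = F.natDegree := by
    rw [hG, (monic_integralNormalization hF0).natDegree_map, natDegree_integralNormalization]
  have hsp : G.Splits := IsAlgClosed.splits G
  have hcard : Multiset.card G.roots = F.natDegree := by
    rw [← hGd, splits_iff_card_roots.1 hsp]
  obtain ⟨y, hy⟩ : ∃ y : Fin F.natDegree → K, Multiset.map y Finset.univ.val = G.roots := by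
    rw [← hcard]
    refine Quotient.inductionOn G.roots fun l => ⟨l.get, ?_⟩
    have h := Fin.univ_val_map l.get
    rw [List.ofFn_get] at h
    exact h
  have hprod : G = ∏ i, (X - C (y i)) := by
    conv_lhs => rw [hsp.eq_prod_roots_of_monic hGm, ← hy]
    rw [Multiset.map_map]; rfl
  have himg : (Finset.univ.image y : Set K) = (a * ·) '' {x | (F.map φ).IsRoot x} := by
    have h1 : ∀ z, z ∈ Finset.univ.image y ↔ G.IsRoot z := by
      intro z
      rw [← mem_roots hGm.ne_zero, ← hy]
      simp
    have h2 : ∀ x, G.IsRoot (a * x) ↔ (F.map φ).IsRoot x := by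
      intro x
      rw [IsRoot, IsRoot, hG, eval_map, eval_map, integralNormalization_eval₂_leadingCoeff_mul hF,
        mul_eq_zero, or_iff_right (pow_ne_zero _ ha)]
    ext z
    rw [Finset.mem_coe, h1]
    constructor
    · intro hz
      refine ⟨a⁻¹ * z, ?_, ?_⟩
      · rw [Set.mem_ofPred_eq, ← h2, mul_inv_cancel_left₀ ha]; exact hz
      · exact mul_inv_cancel_left₀ ha z
    · rintro ⟨x, hx, rfl⟩
      exact (h2 x).2 hx
  have hc : (Finset.univ.image y).card = {x | (F.map φ).IsRoot x}.ncard := by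
    rw [← Set.ncard_coe_finset, himg, Set.ncard_image_of_injective _ (mul_right_injective₀ ha)]
  rw [← hc] at hle ⊢
  rw [← hankel_aux _ _ y hle, RingHom.map_det]
  have : (Matrix.of fun i j : Fin k₀ => ∑ r, y r ^ ((i : ℕ) + (j : ℕ))) =
      φ.mapMatrix (Matrix.of fun i j : Fin k₀ => s ((i : ℕ) + (j : ℕ))) := by
    ext i j
    simp [hs _ K φ y hprod]
  rw [this]

/-- checking the separating element via one PSC: suppose that on
`V_L(E)∖V_L(N)` every `I(u)` is zero-dimensional with exactly `k₀ ≥ 2` points, and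
`𝒳 ∈ k[U][T]` has leading coefficient (in `T`) nonvanishing on `V_L(E)∖V_L(N)` and
specializes, at each `u ∈ V_L(E)∖V_L(N)`, to a nonzero scalar multiple of the
characteristic polynomial of multiplication by `t` on `L[X]/I(u)`.  Then there is a
polynomial `p ∈ k[U]` such that for all `u ∈ V_L(E)∖V_L(N)`:
`t` separates `V_L(I(u))` iff `p(u) ≠ 0`. -/
theorem stmt_11 (k L : Type) [Field k] [CharZero k] [Field L] [Algebra k L]
    [IsAlgClosure k L] (m n l : ℕ) (f : Fin l → MvPolynomial (Fin m ⊕ Fin n) k)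
    (t : MvPolynomial (Fin n) k)
    (E N : Finset (MvPolynomial (Fin m) k))
    (k₀ : ℕ) (hk₀ : 2 ≤ k₀)
    (hfin : ∀ u : Fin m → L,
      (∀ g ∈ E, MvPolynomial.aeval u g = 0) → (∃ g ∈ N, MvPolynomial.aeval u g ≠ 0) →
      FiniteDimensional L (MvPolynomial (Fin n) L ⧸ specIdeal k L f u))
    (hcard : ∀ u : Fin m → L,
      (∀ g ∈ E, MvPolynomial.aeval u g = 0) → (∃ g ∈ N, MvPolynomial.aeval u g ≠ 0) →
      Nat.card {p : Fin n → L | ∀ g ∈ specIdeal k L f u, MvPolynomial.aeval p g = 0} = k₀)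
    (𝒳 : Polynomial (MvPolynomial (Fin m) k))
    (hlead : ∀ u : Fin m → L,
      (∀ g ∈ E, MvPolynomial.aeval u g = 0) → (∃ g ∈ N, MvPolynomial.aeval u g ≠ 0) →
      MvPolynomial.aeval u 𝒳.leadingCoeff ≠ 0)
    (hchar : ∀ (u : Fin m → L)
      (hE : ∀ g ∈ E, MvPolynomial.aeval u g = 0) (hN : ∃ g ∈ N, MvPolynomial.aeval u g ≠ 0),
      ∃ c : L, c ≠ 0 ∧
        𝒳.map (MvPolynomial.aeval u).toRingHom
          = c • (letI := hfin u hE hN;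
              LinearMap.charpoly (LinearMap.mulLeft L
                ((Ideal.Quotient.mk (specIdeal k L f u))
                  (MvPolynomial.map (algebraMap k L) t))))) :
    ∃ p : MvPolynomial (Fin m) k,
      ∀ u : Fin m → L,
        (∀ g ∈ E, MvPolynomial.aeval u g = 0) → (∃ g ∈ N, MvPolynomial.aeval u g ≠ 0) →
        (Set.InjOn (fun q : Fin n → L => MvPolynomial.aeval q t)
            {q : Fin n → L | ∀ g ∈ specIdeal k L f u, MvPolynomial.aeval q g = 0}
          ↔ MvPolynomial.aeval u p ≠ 0) := by
  have : IsAlgClosed L := IsAlgClosure.isAlgClosed k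
  have : CharZero L := charZero_of_injective_algebraMap (algebraMap k L).injective
  -- the roots of the specialized polynomial are the values of `t`
  have hroots : ∀ u : Fin m → L,
      (∀ g ∈ E, MvPolynomial.aeval u g = 0) → (∃ g ∈ N, MvPolynomial.aeval u g ≠ 0) →
      {x | (𝒳.map (MvPolynomial.aeval u).toRingHom).IsRoot x} =
        (fun q : Fin n → L => MvPolynomial.aeval q t) ''
          {q : Fin n → L | ∀ g ∈ specIdeal k L f u, MvPolynomial.aeval q g = 0} := by
    intro u hE hN
    obtain ⟨c, hc, h⟩ := hchar u hE hN
    have := hfin u hE hN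
    ext x
    have h1 := roots_aux (specIdeal k L f u) (MvPolynomial.map (algebraMap k L) t) x
    simp only [MvPolynomial.aeval_map_algebraMap] at h1
    rw [Set.mem_ofPred_eq, h, Polynomial.IsRoot, Polynomial.eval_smul, smul_eq_mul, mul_eq_zero,
      or_iff_right hc]
    exact h1
  have hV : ∀ u : Fin m → L,
      (∀ g ∈ E, MvPolynomial.aeval u g = 0) → (∃ g ∈ N, MvPolynomial.aeval u g ≠ 0) →
      {q : Fin n → L | ∀ g ∈ specIdeal k L f u, MvPolynomial.aeval q g = 0}.ncard = k₀ :=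
    fun u hE hN => hcard u hE hN
  by_cases hd : 1 ≤ 𝒳.natDegree
  · obtain ⟨p, hp⟩ := detect_aux 𝒳 k₀ hd
    refine ⟨p, fun u hE hN => ?_⟩
    have hfinV : {q : Fin n → L | ∀ g ∈ specIdeal k L f u,
        MvPolynomial.aeval q g = 0}.Finite :=
      Set.finite_of_ncard_pos (by rw [hV u hE hN]; omega)
    have h := hp L (MvPolynomial.aeval u).toRingHom (hlead u hE hN)
    rw [hroots u hE hN] at h
    have h' := h ((Set.ncard_image_le hfinV).trans (hV u hE hN).le)
    rw [← Set.ncard_image_iff hfinV, hV u hE hN]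
    exact h'
  · refine ⟨0, fun u hE hN => ?_⟩
    exfalso
    have hne : {q : Fin n → L | ∀ g ∈ specIdeal k L f u,
        MvPolynomial.aeval q g = 0}.Nonempty :=
      Set.nonempty_of_ncard_ne_zero (by rw [hV u hE hN]; omega)
    obtain ⟨x, hx⟩ := hne.image (fun q : Fin n → L => MvPolynomial.aeval q t)
    rw [← hroots u hE hN, Set.mem_ofPred_eq] at hx
    have h0 : 𝒳.natDegree = 0 := by omega
    have hl := hlead u hE hN
    rw [Polynomial.leadingCoeff, h0] at hl
    rw [Polynomial.eq_C_of_natDegree_eq_zero h0] at hx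
    rw [Polynomial.map_C, Polynomial.IsRoot, Polynomial.eval_C] at hx
    exact hl hx
end

section
/- Let k be a field of characteristic 0 with algebraic closure L, let f_1,…,f_l ∈ k[U,X], and let E, N be finite subsets of k[U] such that for all ū ∈ V_L(E)∖V_L(N): I(ū) is zero-dimensional and the number of points of V_L(I(ū)) equals a fixed integer k_0. Then there exists a finite set {(E_1,N_1,t_1),…,(E_s,N_s,t_s)} with E_i, N_i finite subsets of k[U] and t_i ∈ k[X], such that V_L(E)∖V_L(N) = ⋃_{i=1}^{s} V_L(E_i)∖V_L(N_i), and for each i, t_i separates V_L(I(ū)) for every ū ∈ V_L(E_i)∖V_L(N_i). -/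
namespace SepAux

open MvPolynomial PrimeSpectrum Topology

lemma exists_extend {k R L : Type} [Field k] [Field R] [Field L] [Algebra k R] [Algebra k L]
    [Algebra.IsAlgebraic k L] [IsAlgClosed L] (a b : R →ₐ[k] L) :
    ∃ σ : L →ₐ[k] L, ∀ r, σ (a r) = b r := by
  have key : ∀ (L₁ L₂ : Type) [Field L₁] [Field L₂] [Algebra k L₁] [Algebra k L₂]
      [Algebra.IsAlgebraic k L₁] [IsAlgClosed L₂] (a : R →ₐ[k] L₁) (b : R →ₐ[k] L₂),
      ∃ σ : L₁ →+* L₂, ∀ r, σ (a r) = b r := by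
    intro L₁ L₂ _ _ _ _ _ _ a b
    let := a.toRingHom.toAlgebra
    let := b.toRingHom.toAlgebra
    have : IsScalarTower k R L₁ := IsScalarTower.of_algebraMap_eq fun x => (a.commutes x).symm
    have : Algebra.IsAlgebraic R L₁ := Algebra.IsAlgebraic.tower_top (K := k) R
    let s : L₁ →ₐ[R] L₂ := IsAlgClosed.lift
    exact ⟨s.toRingHom, fun r => s.commutes r⟩
  obtain ⟨σ, hσ⟩ := key L L a b
  refine ⟨{ σ with commutes' := fun x => ?_ }, hσ⟩
  have := hσ (algebraMap k R x)
  simpa using this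

lemma exists_conj {k L : Type} [Field k] [Field L] [Algebra k L]
    [Algebra.IsAlgebraic k L] [IsAlgClosed L] {m : ℕ} (u u' : Fin m → L)
    (h : ∀ p : MvPolynomial (Fin m) k, aeval u p = 0 → aeval u' p = 0) :
    ∃ σ : L →ₐ[k] L, ∀ i, σ (u' i) = u i := by
  let P : Ideal (MvPolynomial (Fin m) k) := RingHom.ker (aeval u : _ →ₐ[k] L)
  let b : (MvPolynomial (Fin m) k ⧸ P) →ₐ[k] L := Ideal.kerLiftAlg (aeval u : _ →ₐ[k] L)
  have hb : Function.Injective b := Ideal.kerLiftAlg_injective _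
  have hfld : IsField (MvPolynomial (Fin m) k ⧸ P) := by
    have : P.IsPrime := RingHom.ker_isPrime _
    have : Algebra.IsIntegral k (MvPolynomial (Fin m) k ⧸ P) := Algebra.IsIntegral.of_injective b hb
    exact isField_of_isIntegral_of_isField' (Field.toIsField k)
  have : P.IsMaximal := Ideal.Quotient.maximal_of_isField _ hfld
  let := Ideal.Quotient.field P
  let a : (MvPolynomial (Fin m) k ⧸ P) →ₐ[k] L :=
    Ideal.Quotient.liftₐ P (aeval u' : _ →ₐ[k] L) (fun p hp => h p hp)
  obtain ⟨σ, hσ⟩ := exists_extend a b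
  refine ⟨σ, fun i => ?_⟩
  have := hσ (Ideal.Quotient.mk P (X i))
  have e1 : a (Ideal.Quotient.mk P (X i)) = u' i := by
    change aeval u' (X i : MvPolynomial (Fin m) k) = u' i
    simp
  have e2 : b (Ideal.Quotient.mk P (X i)) = u i := by
    change aeval u (X i : MvPolynomial (Fin m) k) = u i
    simp
  rwa [e1, e2] at this

/-- the prime of a point -/
noncomputable def pt {k L : Type} [Field k] [Field L] [Algebra k L] {τ : Type} (u : τ → L) :
    PrimeSpectrum (MvPolynomial τ k) :=
  ⟨RingHom.ker (aeval u : _ →ₐ[k] L), RingHom.ker_isPrime _⟩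

lemma mem_pt {k L : Type} [Field k] [Field L] [Algebra k L] {τ : Type} (u : τ → L)
    (p : MvPolynomial τ k) : p ∈ (pt (k := k) u).asIdeal ↔ aeval u p = 0 := Iff.rfl

lemma constructible_vd {R : Type} [CommRing R] (G H : Finset R) :
    IsConstructible {Q : PrimeSpectrum R | (∀ g ∈ G, g ∈ Q.asIdeal) ∧ ∃ h ∈ H, h ∉ Q.asIdeal} := by
  have hc : ∀ G : Finset R, IsConstructible (zeroLocus (G : Set R)) := fun G => by
    rw [← isConstructible_compl]
    exact (isRetrocompact_zeroLocus_compl G.finite_toSet).isConstructible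
      (isClosed_zeroLocus _).isOpen_compl
  convert (hc G).sdiff (hc H) using 1
  ext Q
  simp [mem_zeroLocus, Set.subset_def]

lemma proj {k L : Type} [Field k] [Field L] [Algebra k L]
    [Algebra.IsAlgebraic k L] [IsAlgClosed L] {m : ℕ} {τ : Type} [Finite τ]
    (G H : Finset (MvPolynomial (Fin m ⊕ τ) k)) :
    ∃ B : Set (PrimeSpectrum (MvPolynomial (Fin m) k)), IsConstructible B ∧
      ∀ u : Fin m → L, pt u ∈ B ↔ ∃ v : τ → L, (∀ g ∈ G, aeval (Sum.elim u v) g = 0) ∧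
        ∃ h ∈ H, aeval (Sum.elim u v) h ≠ 0 := by
  let φ : MvPolynomial (Fin m) k →ₐ[k] MvPolynomial (Fin m ⊕ τ) k := rename Sum.inl
  have hφ : φ.toRingHom.FinitePresentation := by
    let := φ.toRingHom.toAlgebra
    have : IsScalarTower k (MvPolynomial (Fin m) k) (MvPolynomial (Fin m ⊕ τ) k) :=
      IsScalarTower.of_algebraMap_eq fun x => (φ.commutes x).symm
    exact Algebra.FinitePresentation.of_restrict_scalars_finitePresentation k _ _
  refine ⟨_, isConstructible_comap_image hφ (constructible_vd G H), fun u => ?_⟩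
  constructor
  · rintro ⟨Q, ⟨hG, h, hH, hh⟩, hQ⟩
    have hz := IsPrime.vanishingIdeal_zeroLocus (K := L) Q.asIdeal
    rw [← hz, mem_vanishingIdeal_iff] at hh
    push Not at hh
    obtain ⟨w, hw, hwh⟩ := hh
    have hu : ∀ p : MvPolynomial (Fin m) k, aeval u p = 0 → aeval (w ∘ Sum.inl) p = 0 := by
      intro p hp
      rw [← mem_pt, ← hQ] at hp
      have := hw _ hp
      change aeval w (rename Sum.inl p) = 0 at this
      rwa [aeval_rename] at this
    obtain ⟨σ, hσ⟩ := exists_conj u _ hu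
    have hs : ∀ p : MvPolynomial (Fin m ⊕ τ) k,
        aeval (Sum.elim u (fun i => σ (w (Sum.inr i)))) p = σ (aeval w p) := by
      intro p
      have e : Sum.elim u (fun i => σ (w (Sum.inr i))) = fun i => σ (w i) := by
        ext i
        rcases i with i | i
        · exact (hσ i).symm
        · rfl
      rw [e]
      have : (aeval (fun i => σ (w i)) : MvPolynomial (Fin m ⊕ τ) k →ₐ[k] L)
          = σ.comp (aeval w) := by ext i; simp
      rw [this]; rfl
    refine ⟨fun i => σ (w (Sum.inr i)), fun g hg => ?_, h, hH, ?_⟩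
    · rw [hs, hw g (hG g hg), map_zero]
    · rw [hs]
      exact fun h0 => hwh (σ.toRingHom.injective (h0.trans (map_zero σ).symm))
  · rintro ⟨v, hG, h, hH, hh⟩
    refine ⟨pt (Sum.elim u v), ⟨hG, h, hH, hh⟩, ?_⟩
    ext p
    change aeval (Sum.elim u v) (rename Sum.inl p) = 0 ↔ aeval u p = 0
    rw [aeval_rename]; rfl

/-- the candidate separating forms -/
noncomputable def cand (k : Type) [Field k] (n c : ℕ) : MvPolynomial (Fin n) k :=
  ∑ i : Fin n, C ((c : k) ^ (i : ℕ)) * X i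

lemma exists_sep {k L : Type} [Field k] [CharZero k] [Field L] [Algebra k L] (n k₀ : ℕ)
    (S : Set (Fin n → L)) (hS : S.Finite) (hk : Nat.card S = k₀) :
    ∃ c : Fin (k₀ * k₀ * n + 1), Set.InjOn (fun q : Fin n → L => aeval q (cand k n c)) S := by
  classical
  have : CharZero L := charZero_of_injective_algebraMap (algebraMap k L).injective
  let D : (Fin n → L) × (Fin n → L) → Polynomial L := fun pq =>
    ∑ i : Fin n, Polynomial.C (pq.1 i - pq.2 i) * Polynomial.X ^ (i : ℕ)
  have hDe : ∀ pq (c : ℕ), (D pq).eval (c : L) = aeval pq.1 (cand k n c) - aeval pq.2 (cand k n c) := by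
    intro pq c
    simp only [D, cand, Polynomial.eval_finsetSum, map_sum, ← Finset.sum_sub_distrib]
    refine Finset.sum_congr rfl fun i _ => ?_
    simp
    ring
  have hD0 : ∀ pq, pq.1 ≠ pq.2 → D pq ≠ 0 := by
    intro pq hne h0
    apply hne
    ext i
    have := congrArg (fun p => Polynomial.coeff p (i : ℕ)) h0
    simp only [D, Polynomial.finsetSum_coeff, Polynomial.coeff_C_mul, Polynomial.coeff_X_pow,
      Polynomial.coeff_zero] at this
    rw [Finset.sum_eq_single i] at this
    · simpa [sub_eq_zero] using this
    · intro j _ hj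
      have : (i : ℕ) ≠ j := fun h => hj (Fin.ext h.symm)
      simp [this]
    · simp
  have hDd : ∀ pq, (D pq).natDegree ≤ n := by
    intro pq
    refine Polynomial.natDegree_sum_le_of_forall_le _ _ fun i _ => ?_
    exact (Polynomial.natDegree_C_mul_X_pow_le _ _).trans i.2.le
  let T := hS.toFinset
  have hT : T.card = k₀ := by rw [← hk, Nat.card_eq_card_finite_toFinset hS]
  let F := ∏ pq ∈ T.offDiag, D pq
  have hF : F ≠ 0 := Finset.prod_ne_zero_iff.2 fun pq h => hD0 _ (Finset.mem_offDiag.1 h).2.2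
  have hFd : F.natDegree ≤ k₀ * k₀ * n := by
    refine (Polynomial.natDegree_prod_le _ _).trans ?_
    refine (Finset.sum_le_card_nsmul _ _ n fun pq _ => hDd pq).trans ?_
    rw [Finset.offDiag_card, hT, smul_eq_mul]
    exact Nat.mul_le_mul_right _ (Nat.sub_le _ _)
  by_contra hcon
  push Not at hcon
  apply hF
  refine Polynomial.eq_zero_of_natDegree_lt_card_of_eval_eq_zero F
    (f := fun c : Fin (k₀ * k₀ * n + 1) => ((c : ℕ) : L)) ?_ ?_ ?_
  · intro a b hab
    exact Fin.ext (Nat.cast_injective hab)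
  · intro c
    have := hcon c
    simp only [Set.InjOn] at this
    push Not at this
    obtain ⟨p, hp, q, hq, hpq, hne⟩ := this
    rw [Polynomial.eval_prod]
    refine Finset.prod_eq_zero (i := (p, q)) ?_ ?_
    · simp [T, hp, hq, hne]
    · rw [hDe]; simp [hpq]
  · simpa using Nat.lt_succ_of_le hFd

lemma finite_zeros {L : Type} [Field L] {n : ℕ} (I : Ideal (MvPolynomial (Fin n) L))
    [FiniteDimensional L (MvPolynomial (Fin n) L ⧸ I)] :
    {p : Fin n → L | ∀ g ∈ I, aeval p g = 0}.Finite := by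
  rw [← Set.finite_coe_iff]
  refine Finite.of_injective (β := (MvPolynomial (Fin n) L ⧸ I) →ₐ[L] L)
    (fun p => Ideal.Quotient.liftₐ I (aeval p.1) p.2) ?_
  intro p q h
  ext i
  have := congrArg (fun φ : (MvPolynomial (Fin n) L ⧸ I) →ₐ[L] L =>
    φ (Ideal.Quotient.mk I (X i))) h
  simpa using this

lemma mem_zeros (k L : Type) [Field k] [Field L] [Algebra k L]
    {m n l : ℕ} (f : Fin l → MvPolynomial (Fin m ⊕ Fin n) k) (u : Fin m → L) (q : Fin n → L) :
    (∀ g ∈ specIdeal k L f u, aeval q g = 0) ↔ ∀ j, aeval (Sum.elim u q) (f j) = 0 := by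
  have h := congrArg (fun S => q ∈ S) (zeroLocus_span (K := L) (Set.range fun j : Fin l =>
    aeval (Sum.elim (fun i => C (u i)) X) (f j) : Set (MvPolynomial (Fin n) L)))
  have h' := iff_of_eq h
  refine h'.trans ?_
  simp only [Set.mem_ofPred_eq, Set.forall_mem_range]
  refine forall_congr' fun j => ?_
  have e : ((aeval q : MvPolynomial (Fin n) L →ₐ[L] L).restrictScalars k).comp
      (aeval (Sum.elim (fun i => C (u i)) X) : MvPolynomial (Fin m ⊕ Fin n) k →ₐ[k] _)
      = aeval (Sum.elim u q) := by
    ext i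
    rcases i with i | i <;> simp
  rw [← e]; rfl

lemma sep_constructible {k L : Type} [Field k] [Field L] [Algebra k L]
    [Algebra.IsAlgebraic k L] [IsAlgClosed L] {m n l : ℕ}
    (f : Fin l → MvPolynomial (Fin m ⊕ Fin n) k)
    (E N : Finset (MvPolynomial (Fin m) k)) (t : MvPolynomial (Fin n) k) :
    ∃ S : ConstructibleSetData (MvPolynomial (Fin m) k), ∀ u : Fin m → L,
      pt u ∈ S.toSet ↔ ((∀ g ∈ E, aeval u g = 0) ∧ ∃ g ∈ N, aeval u g ≠ 0) ∧
        Set.InjOn (fun q : Fin n → L => aeval q t)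
          {q : Fin n → L | ∀ g ∈ specIdeal k L f u, aeval q g = 0} := by
  classical
  let a : Fin n → Fin m ⊕ (Fin n ⊕ Fin n) := fun i => Sum.inr (Sum.inl i)
  let b : Fin n → Fin m ⊕ (Fin n ⊕ Fin n) := fun i => Sum.inr (Sum.inr i)
  let G : Finset (MvPolynomial (Fin m ⊕ (Fin n ⊕ Fin n)) k) :=
    Finset.univ.image (fun j => rename (Sum.elim Sum.inl a) (f j)) ∪
    Finset.univ.image (fun j => rename (Sum.elim Sum.inl b) (f j)) ∪
    {rename a t - rename b t}
  let H : Finset (MvPolynomial (Fin m ⊕ (Fin n ⊕ Fin n)) k) :=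
    Finset.univ.image (fun i : Fin n => X (a i) - X (b i))
  obtain ⟨B, hB, hBu⟩ := proj (L := L) G H
  obtain ⟨S, hS⟩ := exists_constructibleSetData_iff.2 ((constructible_vd E N).sdiff hB)
  refine ⟨S, fun u => ?_⟩
  rw [hS]
  refine and_congr Iff.rfl ?_
  rw [hBu]
  have ea : ∀ v : Fin n ⊕ Fin n → L, Sum.elim u v ∘ a = v ∘ Sum.inl := fun v => rfl
  have eb : ∀ v : Fin n ⊕ Fin n → L, Sum.elim u v ∘ b = v ∘ Sum.inr := fun v => rfl
  have ea' : ∀ v : Fin n ⊕ Fin n → L,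
      Sum.elim u v ∘ Sum.elim Sum.inl a = Sum.elim u (v ∘ Sum.inl) := fun v => by
    ext i; rcases i with i | i <;> rfl
  have eb' : ∀ v : Fin n ⊕ Fin n → L,
      Sum.elim u v ∘ Sum.elim Sum.inl b = Sum.elim u (v ∘ Sum.inr) := fun v => by
    ext i; rcases i with i | i <;> rfl
  constructor
  · intro hn p hp q hq hpq
    by_contra hne
    apply hn
    simp only [Set.mem_ofPred_eq, mem_zeros] at hp hq
    refine ⟨Sum.elim p q, ?_, ?_⟩
    · intro g hg
      simp only [G, Finset.mem_union, Finset.mem_image, Finset.mem_singleton, Finset.mem_univ,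
        true_and] at hg
      rcases hg with (⟨j, rfl⟩ | ⟨j, rfl⟩) | rfl
      · rw [aeval_rename, ea']; exact hp j
      · rw [aeval_rename, eb']; exact hq j
      · rw [map_sub, aeval_rename, aeval_rename, ea, eb]
        exact sub_eq_zero.2 hpq
    · obtain ⟨i, hi⟩ := Function.ne_iff.1 hne
      refine ⟨X (a i) - X (b i), Finset.mem_image_of_mem _ (Finset.mem_univ i), ?_⟩
      simpa [a, b, sub_eq_zero] using hi
  · rintro hinj ⟨v, hG, h, hH, hh⟩
    obtain ⟨i, -, rfl⟩ := Finset.mem_image.1 hH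
    have hp : v ∘ Sum.inl ∈ {q : Fin n → L | ∀ g ∈ specIdeal k L f u, aeval q g = 0} := by
      simp only [Set.mem_ofPred_eq, mem_zeros]
      intro j
      have := hG (rename (Sum.elim Sum.inl a) (f j)) (by simp [G])
      rwa [aeval_rename, ea'] at this
    have hq : v ∘ Sum.inr ∈ {q : Fin n → L | ∀ g ∈ specIdeal k L f u, aeval q g = 0} := by
      simp only [Set.mem_ofPred_eq, mem_zeros]
      intro j
      have := hG (rename (Sum.elim Sum.inl b) (f j)) (by simp [G])
      rwa [aeval_rename, eb'] at this
    have ht := hG (rename a t - rename b t) (by simp [G])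
    rw [map_sub, aeval_rename, aeval_rename, ea, eb, sub_eq_zero] at ht
    have := congrFun (hinj hp hq ht) i
    apply hh
    simpa [a, b, sub_eq_zero] using this

end SepAux

/-- partition according to separating elements: if on `V_L(E)∖V_L(N)` every
`I(u)` is zero-dimensional with exactly `k₀` points, then `V_L(E)∖V_L(N)` can be covered by
finitely many branches `V_L(E_i)∖V_L(N_i)`, on each of which a single polynomial
`t_i ∈ k[X]` separates `V_L(I(u))`. -/
theorem stmt_12 (k L : Type) [Field k] [CharZero k] [Field L] [Algebra k L]
    [IsAlgClosure k L] (m n l : ℕ) (f : Fin l → MvPolynomial (Fin m ⊕ Fin n) k)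
    (E N : Finset (MvPolynomial (Fin m) k)) (k₀ : ℕ)
    (hfin : ∀ u : Fin m → L,
      (∀ g ∈ E, MvPolynomial.aeval u g = 0) → (∃ g ∈ N, MvPolynomial.aeval u g ≠ 0) →
      FiniteDimensional L (MvPolynomial (Fin n) L ⧸ specIdeal k L f u))
    (hcard : ∀ u : Fin m → L,
      (∀ g ∈ E, MvPolynomial.aeval u g = 0) → (∃ g ∈ N, MvPolynomial.aeval u g ≠ 0) →
      Nat.card {p : Fin n → L | ∀ g ∈ specIdeal k L f u, MvPolynomial.aeval p g = 0} = k₀) :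
    ∃ (s : ℕ) (Es Ns : Fin s → Finset (MvPolynomial (Fin m) k))
      (ts : Fin s → MvPolynomial (Fin n) k),
      (∀ u : Fin m → L,
        ((∀ g ∈ E, MvPolynomial.aeval u g = 0) ∧ (∃ g ∈ N, MvPolynomial.aeval u g ≠ 0))
          ↔ ∃ i : Fin s, (∀ g ∈ Es i, MvPolynomial.aeval u g = 0) ∧
              (∃ g ∈ Ns i, MvPolynomial.aeval u g ≠ 0)) ∧
      (∀ (i : Fin s) (u : Fin m → L),
        (∀ g ∈ Es i, MvPolynomial.aeval u g = 0) → (∃ g ∈ Ns i, MvPolynomial.aeval u g ≠ 0) →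
        Set.InjOn (fun q : Fin n → L => MvPolynomial.aeval q (ts i))
          {q : Fin n → L | ∀ g ∈ specIdeal k L f u, MvPolynomial.aeval q g = 0}) := by
  classical
  have : IsAlgClosed L := IsAlgClosure.isAlgClosed k
  have : Algebra.IsAlgebraic k L := IsAlgClosure.isAlgebraic
  choose S hS using fun c : Fin (k₀ * k₀ * n + 1) =>
    SepAux.sep_constructible (L := L) f E N (SepAux.cand k n c)
  have hmem : ∀ (C : PrimeSpectrum.BasicConstructibleSetData (MvPolynomial (Fin m) k))
      (u : Fin m → L), SepAux.pt u ∈ C.toSet ↔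
        (∀ g ∈ Finset.univ.image C.g, MvPolynomial.aeval u g = 0) ∧
          ∃ g ∈ ({C.f} : Finset (MvPolynomial (Fin m) k)), MvPolynomial.aeval u g ≠ 0 := by
    intro C u
    simp [PrimeSpectrum.BasicConstructibleSetData.toSet, PrimeSpectrum.mem_zeroLocus,
      Set.range_subset_iff, SepAux.mem_pt]
  have hmem' : ∀ c (u : Fin m → L), SepAux.pt u ∈ (S c).toSet ↔ ∃ C : S c,
      SepAux.pt u ∈ C.1.toSet := by
    intro c u
    simp [PrimeSpectrum.ConstructibleSetData.toSet]
  let ι := Σ c : Fin (k₀ * k₀ * n + 1), S c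
  let e := Fintype.equivFin ι
  refine ⟨Fintype.card ι, fun i => Finset.univ.image (e.symm i).2.1.g,
    fun i => {(e.symm i).2.1.f}, fun i => SepAux.cand k n (e.symm i).1, ?_, ?_⟩
  · intro u
    constructor
    · rintro ⟨hE, hN⟩
      have := hfin u hE hN
      obtain ⟨c, hc⟩ := SepAux.exists_sep (k := k) n k₀ _
        (SepAux.finite_zeros (specIdeal k L f u)) (hcard u hE hN)
      obtain ⟨C, hC⟩ := (hmem' c u).1 ((hS c u).2 ⟨⟨hE, hN⟩, hc⟩)
      refine ⟨e ⟨c, C⟩, ?_⟩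
      beta_reduce
      rw [e.symm_apply_apply]
      exact (hmem _ u).1 hC
    · rintro ⟨i, hi⟩
      exact ((hS _ u).1 ((hmem' _ u).2 ⟨(e.symm i).2, (hmem _ u).2 hi⟩)).1
  · intro i u h1 h2
    exact ((hS _ u).1 ((hmem' _ u).2 ⟨(e.symm i).2, (hmem _ u).2 ⟨h1, h2⟩⟩)).2
end

section
/- Let k be a field of characteristic 0 with algebraic closure L, let f_1,…,f_l ∈ k[U,X], let t ∈ k[X], and let E, N be finite subsets of k[U] such that for all ū ∈ V_L(E)∖V_L(N): I(ū) is zero-dimensional and t separates V_L(I(ū)). Suppose 𝒳 ∈ k[U][T] is a polynomial whose leading coefficient in T does not vanish on V_L(E)∖V_L(N) and such that for every ū ∈ V_L(E)∖V_L(N), 𝒳(ū,T) is a nonzero scalar multiple in L[T] of the characteristic polynomial of the multiplication map by t on L[X]/I(ū). Then there exist finitely many tuples (E_i, N_i, g_i, g_{i1}, …, g_{in}), i = 1,…,s, with E_i, N_i finite subsets of k[U] and g_i, g_{i1},…,g_{in} ∈ k[U][T], such that V_L(E)∖V_L(N) = ⋃_{i=1}^{s} V_L(E_i)∖V_L(N_i),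 and for each i and every ū ∈ V_L(E_i)∖V_L(N_i): g_i(ū,β) ≠ 0 for every root β ∈ L of 𝒳(ū,T), and V_L(I(ū)) = { ( g_{i1}(ū,β)/g_i(ū,β), …, g_{in}(ū,β)/g_i(ū,β) ) : β ∈ L, 𝒳(ū,β) = 0 }. -/
theorem exists_algHom_of_finiteType (K Ω B : Type) [Field K] [Field Ω] [Algebra K Ω] [IsAlgClosed Ω]
    [CommRing B] [Algebra K B] [Nontrivial B] [Algebra.FiniteType K B] : Nonempty (B →ₐ[K] Ω) := by
  obtain ⟨M, hM⟩ := Ideal.exists_maximal B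
  let _ : Field (B ⧸ M) := Ideal.Quotient.field M
  have : Algebra.FiniteType K (B ⧸ M) :=
    Algebra.FiniteType.of_surjective (Ideal.Quotient.mkₐ K M) (Ideal.Quotient.mkₐ_surjective K M)
  have : Module.Finite K (B ⧸ M) := finite_of_finite_type_of_isJacobsonRing K (B ⧸ M)
  exact ⟨(IsAlgClosed.lift (R := K) (S := B ⧸ M) (M := Ω)).comp (Ideal.Quotient.mkₐ K M)⟩

theorem transfer_point (K Ω M σ : Type) [Field K] [Field Ω] [Algebra K Ω] [IsAlgClosed Ω]
    [Field M] [Algebra K M] [Finite σ] (y : σ → M) (F : MvPolynomial σ K)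
    (hF : MvPolynomial.aeval y F ≠ 0) :
    ∃ y' : σ → Ω, MvPolynomial.aeval y' F ≠ 0 ∧
      ∀ G : MvPolynomial σ K, MvPolynomial.aeval y G = 0 → MvPolynomial.aeval y' G = 0 := by
  classical
  let φ : MvPolynomial (Option σ) K →ₐ[K] M :=
    MvPolynomial.aeval (fun o => o.elim (MvPolynomial.aeval y F)⁻¹ y)
  have hft : Algebra.FiniteType K φ.range :=
    Algebra.FiniteType.of_surjective φ.rangeRestrict φ.rangeRestrict_surjective
  obtain ⟨ψ⟩ := exists_algHom_of_finiteType K Ω φ.range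
  have key : ∀ G : MvPolynomial σ K,
      MvPolynomial.aeval (fun s => ψ (φ.rangeRestrict (MvPolynomial.X (some s)))) G
        = ψ (φ.rangeRestrict (MvPolynomial.rename some G)) := by
    intro G
    have : MvPolynomial.aeval (fun s => ψ (φ.rangeRestrict (MvPolynomial.X (some s))))
        = (ψ.comp φ.rangeRestrict).comp (MvPolynomial.rename (R := K) some) := by
      ext s; simp
    rw [this]; rfl
  have hφ : ∀ G : MvPolynomial σ K, φ (MvPolynomial.rename some G) = MvPolynomial.aeval y G := by
    intro G
    simp only [φ, MvPolynomial.aeval_rename]; rfl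
  refine ⟨fun s => ψ (φ.rangeRestrict (MvPolynomial.X (some s))), ?_, ?_⟩
  · rw [key]
    intro h0
    have h1 : φ.rangeRestrict (MvPolynomial.rename some F) * φ.rangeRestrict (MvPolynomial.X none) = 1 := by
      apply Subtype.ext
      change φ (MvPolynomial.rename some F) * φ (MvPolynomial.X none) = 1
      rw [hφ]; simp [φ, hF]
    have := congrArg ψ h1
    rw [map_mul, h0, zero_mul, map_one] at this
    exact zero_ne_one this
  · intro G hG
    rw [key]
    have : φ.rangeRestrict (MvPolynomial.rename some G) = 0 := by
      apply Subtype.ext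
      change φ (MvPolynomial.rename some G) = 0
      rw [hφ, hG]
    rw [this, map_zero]

theorem lagrange_exists {ι F : Type} [Field F] (s : Finset ι) (v r : ι → F)
    (h : Set.InjOn v (s : Set ι)) :
    ∃ p : Polynomial F, (∀ i ∈ s, p.eval (v i) = r i) ∧ p.degree < s.card := by
  classical
  exact ⟨Lagrange.interpolate s v r, fun i hi => Lagrange.eval_interpolate_at_node r h hi,
    Lagrange.degree_interpolate_lt r h⟩

theorem galois_interp (K Ω : Type) [Field K] [Field Ω] [Algebra K Ω] [IsGalois K Ω] {n : ℕ}
    (V : Set (Fin n → Ω)) (hV : V.Finite) (t : (Fin n → Ω) → Ω) (hinj : Set.InjOn t V)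
    (hst : ∀ (σ : Ω ≃ₐ[K] Ω), ∀ q ∈ V, (fun i => σ (q i)) ∈ V)
    (ht : ∀ (σ : Ω ≃ₐ[K] Ω) q, t (fun i => σ (q i)) = σ (t q)) (j : Fin n) :
    ∃ p : Polynomial K, ∀ q ∈ V, Polynomial.aeval (t q) p = q j := by
  have hinj' : Set.InjOn t (hV.toFinset : Set (Fin n → Ω)) := by
    rw [Set.Finite.coe_toFinset]; exact hinj
  obtain ⟨p, hev, hdeg⟩ : ∃ p : Polynomial Ω, (∀ q ∈ V, p.eval (t q) = q j) ∧
      p.degree < hV.toFinset.card :=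
    by
      obtain ⟨p, h1, h2⟩ := lagrange_exists hV.toFinset t (fun q => q j) hinj'
      exact ⟨p, fun q hq => h1 q (hV.mem_toFinset.2 hq), h2⟩
  have hfix : ∀ σ : Ω ≃ₐ[K] Ω, p.map (σ : Ω →+* Ω) = p := by
    intro σ
    refine Polynomial.eq_of_degrees_lt_of_eval_index_eq hV.toFinset hinj'
      (lt_of_le_of_lt Polynomial.degree_map_le hdeg) hdeg ?_
    intro q hq
    have hq : q ∈ V := by simpa using hq
    have h1 := hst σ.symm q hq
    have h2 := ht σ.symm q
    have h3 : t q = (σ : Ω →+* Ω) (t fun i => σ.symm (q i)) := by rw [h2]; simp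
    rw [hev q hq, h3, Polynomial.eval_map, Polynomial.eval₂_at_apply, hev _ h1]
    simp
  have hl : p ∈ Polynomial.lifts (algebraMap K Ω) := by
    rw [Polynomial.lifts_iff_coeff_lifts]
    intro i
    have : p.coeff i ∈ (⊥ : IntermediateField K Ω) := by
      rw [InfiniteGalois.mem_bot_iff_fixed]
      intro σ
      conv_rhs => rw [← hfix σ]
      simp
    exact IntermediateField.mem_bot.mp this
  obtain ⟨p0, hp0⟩ := (Polynomial.mem_lifts p).1 hl
  refine ⟨p0, fun q hq => ?_⟩
  rw [← hev q hq, ← hp0, Polynomial.eval_map_algebraMap]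

theorem aeval_spec (k K L : Type) [Field k] [CommRing K] [CommRing L] [Algebra k K] [Algebra k L] [Algebra K L]
    [IsScalarTower k K L] {m n : ℕ} (v : Fin m → K) (q : Fin n → L)
    (F : MvPolynomial (Fin m ⊕ Fin n) k) :
    MvPolynomial.aeval q (MvPolynomial.aeval (R := k)
      (Sum.elim (fun i => (MvPolynomial.C (v i) : MvPolynomial (Fin n) K)) MvPolynomial.X) F)
    = MvPolynomial.aeval (Sum.elim (fun i => algebraMap K L (v i)) q) F := by
  have : ((MvPolynomial.aeval q : MvPolynomial (Fin n) K →ₐ[K] L).restrictScalars k).comp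
      (MvPolynomial.aeval (R := k)
      (Sum.elim (fun i => (MvPolynomial.C (v i) : MvPolynomial (Fin n) K)) MvPolynomial.X))
      = MvPolynomial.aeval (Sum.elim (fun i => algebraMap K L (v i)) q) := by
    apply MvPolynomial.algHom_ext
    rintro (i | i) <;> simp
  exact DFunLike.congr_fun this F

/-- zero condition -/
theorem mem_spec_iff (k L : Type) [Field k] [Field L] [Algebra k L]
    {m n l : ℕ} (f : Fin l → MvPolynomial (Fin m ⊕ Fin n) k) (u : Fin m → L) (q : Fin n → L) :
    (∀ g ∈ (Ideal.span (Set.range fun j : Fin l =>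
    MvPolynomial.aeval (Sum.elim (fun i => MvPolynomial.C (u i)) MvPolynomial.X) (f j)) : Ideal (MvPolynomial (Fin n) L)), MvPolynomial.aeval q g = 0) ↔
      ∀ j, MvPolynomial.aeval (Sum.elim u q) (f j) = 0 := by
  constructor
  · intro h j
    have := h _ (Ideal.subset_span ⟨j, rfl⟩)
    rw [aeval_spec] at this
    exact this
  · intro h g hg
    have : (Ideal.span (Set.range fun j : Fin l =>
    MvPolynomial.aeval (Sum.elim (fun i => MvPolynomial.C (u i)) MvPolynomial.X) (f j)) : Ideal (MvPolynomial (Fin n) L)) ≤ RingHom.ker (MvPolynomial.aeval q : MvPolynomial (Fin n) L →ₐ[L] L) := by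
      rw [Ideal.span_le]
      rintro _ ⟨j, rfl⟩
      change MvPolynomial.aeval q _ = 0
      rw [aeval_spec]; exact h j
    exact this hg

noncomputable abbrev GenK (k : Type) [Field k] {m : ℕ} (P : Ideal (MvPolynomial (Fin m) k)) : Type :=
  FractionRing (MvPolynomial (Fin m) k ⧸ P)

noncomputable def genPt (k : Type) [Field k] {m : ℕ} (P : Ideal (MvPolynomial (Fin m) k)) :
    Fin m → GenK k P :=
  fun i => algebraMap (MvPolynomial (Fin m) k ⧸ P) _ (Ideal.Quotient.mk P (MvPolynomial.X i))

theorem aeval_genPt (k : Type) [Field k] {m : ℕ} (P : Ideal (MvPolynomial (Fin m) k))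
    (p : MvPolynomial (Fin m) k) : MvPolynomial.aeval (genPt k P) p =
      algebraMap (MvPolynomial (Fin m) k ⧸ P) (GenK k P) (Ideal.Quotient.mk P p) := by
  have : MvPolynomial.aeval (genPt k P) =
    (IsScalarTower.toAlgHom k (MvPolynomial (Fin m) k ⧸ P) (GenK k P)).comp (Ideal.Quotient.mkₐ k P) := by
    apply MvPolynomial.algHom_ext
    intro i; simp [genPt]
  rw [this]; rfl

theorem aeval_genPt_eq_zero (k : Type) [Field k] {m : ℕ} (P : Ideal (MvPolynomial (Fin m) k))
    [P.IsPrime] (p : MvPolynomial (Fin m) k) : MvPolynomial.aeval (genPt k P) p = 0 ↔ p ∈ P := by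
  rw [aeval_genPt, FaithfulSMul.algebraMap_eq_zero_iff, Ideal.Quotient.eq_zero_iff_mem]

theorem spread (k : Type) [Field k] {m n l : ℕ} (P : Ideal (MvPolynomial (Fin m) k)) [P.IsPrime]
    (f : Fin l → MvPolynomial (Fin m ⊕ Fin n) k) (F : MvPolynomial (Fin m ⊕ Fin n) k)
    (hF : ∀ q : Fin n → AlgebraicClosure (GenK k P),
      (∀ j, MvPolynomial.aeval (Sum.elim (fun i => algebraMap (GenK k P) (AlgebraicClosure (GenK k P)) (genPt k P i)) q) (f j) = 0) →
       MvPolynomial.aeval (Sum.elim (fun i => algebraMap (GenK k P) (AlgebraicClosure (GenK k P)) (genPt k P i)) q) F = 0)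
    (L : Type) [Field L] [Algebra k L] :
    ∃ h ∉ P, ∀ (u : Fin m → L) (q : Fin n → L), (∀ p ∈ P, MvPolynomial.aeval u p = 0) →
      MvPolynomial.aeval u h ≠ 0 → (∀ j, MvPolynomial.aeval (Sum.elim u q) (f j) = 0) →
      MvPolynomial.aeval (Sum.elim u q) F = 0 := by
  let R := MvPolynomial (Fin m ⊕ Fin n) k
  let ι : MvPolynomial (Fin m) k →ₐ[k] R := MvPolynomial.rename Sum.inl
  let J : Ideal R := Ideal.span (Set.range f) ⊔ P.map ι
  let S : Submonoid R := P.primeCompl.map ι ⊔ Submonoid.powers F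
  by_cases hd : Disjoint (J : Set R) (S : Set R)
  · exfalso
    obtain ⟨𝔮, h𝔮, hJ𝔮, hS⟩ := Ideal.exists_le_prime_disjoint J S hd
    have hFq : F ∉ 𝔮 := fun h => Set.disjoint_left.1 hS h
      (Submonoid.mem_sup_right (Submonoid.mem_powers F))
    have hPq : ∀ p, ι p ∈ 𝔮 ↔ p ∈ P := by
      intro p
      constructor
      · intro h
        by_contra hp
        exact Set.disjoint_left.1 hS h (Submonoid.mem_sup_left ⟨p, hp, rfl⟩)
      · intro h
        exact hJ𝔮 (Ideal.mem_sup_right (Ideal.mem_map_of_mem ι h))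
    let M := FractionRing (R ⧸ 𝔮)
    let a : R →ₐ[k] M := (IsScalarTower.toAlgHom k (R ⧸ 𝔮) M).comp (Ideal.Quotient.mkₐ k 𝔮)
    have ha : ∀ r, a r = 0 ↔ r ∈ 𝔮 := by
      intro r
      change algebraMap (R ⧸ 𝔮) M (Ideal.Quotient.mk 𝔮 r) = 0 ↔ _
      rw [FaithfulSMul.algebraMap_eq_zero_iff, Ideal.Quotient.eq_zero_iff_mem]
    let b : (MvPolynomial (Fin m) k ⧸ P) →ₐ[k] M := Ideal.Quotient.liftₐ P (a.comp ι)
      (fun p hp => (ha _).2 ((hPq p).2 hp))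
    have hb : Function.Injective b := by
      rw [injective_iff_map_eq_zero]
      intro x hx
      obtain ⟨p, rfl⟩ := Ideal.Quotient.mk_surjective x
      rw [Ideal.Quotient.eq_zero_iff_mem, ← hPq, ← ha]
      exact hx
    let c : GenK k P →ₐ[k] M := IsFractionRing.liftAlgHom (g := b) hb
    let _ : Algebra (GenK k P) M := c.toRingHom.toAlgebra
    have : IsScalarTower k (GenK k P) M := IsScalarTower.of_algebraMap_eq (fun x => (c.commutes x).symm)
    have hc : ∀ i, algebraMap (GenK k P) M (genPt k P i) = a (MvPolynomial.X (Sum.inl i)) := by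
      intro i
      change IsFractionRing.liftAlgHom (g := b) hb (algebraMap _ _ _) = _
      rw [IsFractionRing.liftAlgHom_apply, IsFractionRing.lift_algebraMap]
      change a (ι (MvPolynomial.X i)) = _
      exact congrArg a (MvPolynomial.rename_X Sum.inl i)
    have hG : ∀ G : R, MvPolynomial.aeval (fun i => a (MvPolynomial.X (Sum.inr i)))
        (MvPolynomial.aeval (R := k) (Sum.elim (fun i => (MvPolynomial.C (genPt k P i) : MvPolynomial (Fin n) (GenK k P))) MvPolynomial.X) G) = a G := by
      intro G
      rw [aeval_spec]
      conv_rhs => rw [MvPolynomial.aeval_unique a]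
      congr 2
      funext i
      rcases i with i | i
      · simpa using hc i
      · simp
    obtain ⟨q, hq1, hq2⟩ := transfer_point (GenK k P) (AlgebraicClosure (GenK k P)) M (Fin n)
      (fun i => a (MvPolynomial.X (Sum.inr i)))
      (MvPolynomial.aeval (R := k) (Sum.elim (fun i => (MvPolynomial.C (genPt k P i) : MvPolynomial (Fin n) (GenK k P))) MvPolynomial.X) F)
      (by rw [hG, Ne, ha]; exact hFq)
    rw [aeval_spec] at hq1
    apply hq1
    apply hF
    intro j
    rw [← aeval_spec]
    apply hq2
    rw [hG, ha]
    exact hJ𝔮 (Ideal.mem_sup_left (Ideal.subset_span ⟨j, rfl⟩))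
  · rw [Set.not_disjoint_iff] at hd
    obtain ⟨x, hxJ, hxS⟩ := hd
    obtain ⟨_, ⟨h, hh, rfl⟩, _, ⟨e, rfl⟩, rfl⟩ := Submonoid.mem_sup.1 hxS
    refine ⟨h, hh, fun u q hu hhu hfq => ?_⟩
    have hι : ∀ p, MvPolynomial.aeval (Sum.elim u q) (ι p) = MvPolynomial.aeval u p := by
      intro p
      refine (MvPolynomial.aeval_rename Sum.inl (Sum.elim u q) p).trans ?_
      rw [Sum.elim_comp_inl]
    have hJ : J ≤ RingHom.ker (MvPolynomial.aeval (Sum.elim u q) : R →ₐ[k] L) := by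
      refine sup_le ?_ ?_
      · rw [Ideal.span_le]
        rintro _ ⟨j, rfl⟩
        exact hfq j
      · rw [Ideal.map_le_iff_le_comap]
        intro p hp
        change MvPolynomial.aeval (Sum.elim u q) (ι p) = 0
        rw [hι, hu p hp]
    have := hJ hxJ
    change MvPolynomial.aeval (Sum.elim u q) (ι h * F ^ e) = 0 at this
    rw [map_mul, hι, map_pow] at this
    exact eq_zero_of_pow_eq_zero ((mul_eq_zero.1 this).resolve_left hhu)

/-- Substitute `t(X)` for `T` in a polynomial of `k[U][T]`. -/
noncomputable def toUX {k : Type} [Field k] {m n : ℕ} (p : Polynomial (MvPolynomial (Fin m) k))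
    (t : MvPolynomial (Fin n) k) : MvPolynomial (Fin m ⊕ Fin n) k :=
  (p.map (MvPolynomial.rename Sum.inl : MvPolynomial (Fin m) k →ₐ[k] _).toRingHom).eval
    (MvPolynomial.rename Sum.inr t)

theorem aeval_toUX {k A : Type} [Field k] [CommRing A] [Algebra k A] {m n : ℕ}
    (p : Polynomial (MvPolynomial (Fin m) k))
    (t : MvPolynomial (Fin n) k) (u : Fin m → A) (q : Fin n → A) :
    MvPolynomial.aeval (Sum.elim u q) (toUX p t) =
      (p.map (MvPolynomial.aeval u : MvPolynomial (Fin m) k →ₐ[k] A).toRingHom).eval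
        (MvPolynomial.aeval q t) := by
  have h1 : MvPolynomial.aeval (Sum.elim u q) (MvPolynomial.rename (R := k) Sum.inr t)
      = MvPolynomial.aeval q t := by
    rw [MvPolynomial.aeval_rename, Sum.elim_comp_inr]
  have h2 : (MvPolynomial.aeval (Sum.elim u q) : MvPolynomial _ k →ₐ[k] A).toRingHom.comp
      (MvPolynomial.rename Sum.inl : MvPolynomial (Fin m) k →ₐ[k] _).toRingHom
      = (MvPolynomial.aeval u : MvPolynomial (Fin m) k →ₐ[k] A).toRingHom := by
    ext x
    · simp
    · simp
  rw [toUX, ← h1, ← h2, ← Polynomial.map_map]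
  exact (Polynomial.eval_map_apply
    (MvPolynomial.aeval (Sum.elim u q) : MvPolynomial _ k →ₐ[k] A).toRingHom _).symm

theorem generic_step (k L : Type) [Field k] [CharZero k] [Field L] [Algebra k L]
    [IsAlgClosed L] (m n l : ℕ) (f : Fin l → MvPolynomial (Fin m ⊕ Fin n) k)
    (t : MvPolynomial (Fin n) k)
    (E N : Finset (MvPolynomial (Fin m) k))
    (𝒳 : Polynomial (MvPolynomial (Fin m) k))
    (ha : ∀ u : Fin m → L,
      (∀ g ∈ E, MvPolynomial.aeval u g = 0) → (∃ g ∈ N, MvPolynomial.aeval u g ≠ 0) →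
      MvPolynomial.aeval u 𝒳.leadingCoeff ≠ 0)
    (hb : ∀ u : Fin m → L,
      (∀ g ∈ E, MvPolynomial.aeval u g = 0) → (∃ g ∈ N, MvPolynomial.aeval u g ≠ 0) →
      ∀ q : Fin n → L, (∀ j, MvPolynomial.aeval (Sum.elim u q) (f j) = 0) →
      (𝒳.map (MvPolynomial.aeval u).toRingHom).eval (MvPolynomial.aeval q t) = 0)
    (hc : ∀ u : Fin m → L,
      (∀ g ∈ E, MvPolynomial.aeval u g = 0) → (∃ g ∈ N, MvPolynomial.aeval u g ≠ 0) →
      ∀ q q' : Fin n → L, (∀ j, MvPolynomial.aeval (Sum.elim u q) (f j) = 0) →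
      (∀ j, MvPolynomial.aeval (Sum.elim u q') (f j) = 0) →
      MvPolynomial.aeval q t = MvPolynomial.aeval q' t → q = q')
    (P : Ideal (MvPolynomial (Fin m) k)) [P.IsPrime] (hEP : ∀ g ∈ E, g ∈ P)
    (n0 : MvPolynomial (Fin m) k) (hn0 : n0 ∈ N) (hn0P : n0 ∉ P) :
    ∃ h ∉ P, ∃ g : Fin n → Polynomial (MvPolynomial (Fin m) k),
      ∀ (u : Fin m → L) (q : Fin n → L), (∀ p ∈ P, MvPolynomial.aeval u p = 0) →
      MvPolynomial.aeval u h ≠ 0 → (∀ j, MvPolynomial.aeval (Sum.elim u q) (f j) = 0) →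
      ∀ j, ((g j).map (MvPolynomial.aeval u).toRingHom).eval (MvPolynomial.aeval q t) =
        MvPolynomial.aeval u h * q j := by
  classical
  let K := GenK k P
  let Ω := AlgebraicClosure K
  have hK0 : CharZero K := charZero_of_injective_algebraMap (algebraMap k K).injective
  have hgal : IsGalois K Ω := inferInstance
  let v : Fin m → K := genPt k P
  let w : Fin m → Ω := fun i => algebraMap K Ω (v i)
  have hw : ∀ p : MvPolynomial (Fin m) k, MvPolynomial.aeval w p =
      algebraMap K Ω (MvPolynomial.aeval v p) := fun p =>
    MvPolynomial.aeval_algebraMap_apply Ω v p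
  have hw0 : ∀ p : MvPolynomial (Fin m) k, MvPolynomial.aeval w p = 0 ↔ p ∈ P := by
    intro p
    rw [hw, FaithfulSMul.algebraMap_eq_zero_iff]
    exact aeval_genPt_eq_zero k P p
  -- the leading coefficient
  have hlead : 𝒳.leadingCoeff ∉ P := by
    obtain ⟨u, hu1, hu2⟩ := transfer_point k L Ω (Fin m) w n0 (by rw [Ne, hw0]; exact hn0P)
    intro hmem
    exact ha u (fun g hg => hu2 g ((hw0 g).2 (hEP g hg))) ⟨n0, hn0, hu1⟩
      (hu2 _ ((hw0 _).2 hmem))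
  -- roots
  have hroot : ∀ q : Fin n → Ω, (∀ j, MvPolynomial.aeval (Sum.elim w q) (f j) = 0) →
      (𝒳.map (MvPolynomial.aeval w).toRingHom).eval (MvPolynomial.aeval q t) = 0 := by
    intro q hq
    by_contra hne
    rw [← aeval_toUX] at hne
    obtain ⟨y, hy1, hy2⟩ := transfer_point k L Ω (Fin m ⊕ Fin n) (Sum.elim w q)
      (MvPolynomial.rename Sum.inl n0 * toUX 𝒳 t) (by
        rw [map_mul, MvPolynomial.aeval_rename, Sum.elim_comp_inl]
        exact mul_ne_zero (by rw [Ne, hw0]; exact hn0P) hne)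
    obtain ⟨u, q', rfl⟩ : ∃ u q', y = Sum.elim u q' :=
      ⟨y ∘ Sum.inl, y ∘ Sum.inr, (Sum.elim_comp_inl_inr y).symm⟩
    rw [map_mul, MvPolynomial.aeval_rename, Sum.elim_comp_inl, aeval_toUX] at hy1
    refine right_ne_zero_of_mul hy1 (hb u ?_ ⟨n0, hn0, left_ne_zero_of_mul hy1⟩ q'
      (fun j => hy2 _ (hq j)))
    intro g hg
    have := hy2 (MvPolynomial.rename Sum.inl g)
    rw [MvPolynomial.aeval_rename, Sum.elim_comp_inl, MvPolynomial.aeval_rename,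
      Sum.elim_comp_inl] at this
    exact this ((hw0 g).2 (hEP g hg))
  -- separation
  have hsep : ∀ q q' : Fin n → Ω, (∀ j, MvPolynomial.aeval (Sum.elim w q) (f j) = 0) →
      (∀ j, MvPolynomial.aeval (Sum.elim w q') (f j) = 0) →
      MvPolynomial.aeval q t = MvPolynomial.aeval q' t → q = q' := by
    intro q q' hq hq' htt
    by_contra hne
    obtain ⟨j, hj⟩ := Function.ne_iff.1 hne
    let a1 : Fin m ⊕ Fin n → Fin m ⊕ (Fin n ⊕ Fin n) := Sum.map id Sum.inl
    let a2 : Fin m ⊕ Fin n → Fin m ⊕ (Fin n ⊕ Fin n) := Sum.map id Sum.inr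
    have e1 : ∀ (A : Type) [CommRing A] [Algebra k A] (u : Fin m → A) (x x' : Fin n → A)
        (F : MvPolynomial (Fin m ⊕ Fin n) k),
        MvPolynomial.aeval (Sum.elim u (Sum.elim x x')) (MvPolynomial.rename a1 F)
          = MvPolynomial.aeval (Sum.elim u x) F := by
      intro A _ _ u x x' F
      rw [MvPolynomial.aeval_rename]
      congr 2
      funext i; rcases i with i | i <;> rfl
    have e2 : ∀ (A : Type) [CommRing A] [Algebra k A] (u : Fin m → A) (x x' : Fin n → A)
        (F : MvPolynomial (Fin m ⊕ Fin n) k),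
        MvPolynomial.aeval (Sum.elim u (Sum.elim x x')) (MvPolynomial.rename a2 F)
          = MvPolynomial.aeval (Sum.elim u x') F := by
      intro A _ _ u x x' F
      rw [MvPolynomial.aeval_rename]
      congr 2
      funext i; rcases i with i | i <;> rfl
    have e3 : ∀ (A : Type) [CommRing A] [Algebra k A] (u : Fin m → A) (x : Fin n → A)
        (p : MvPolynomial (Fin m) k),
        MvPolynomial.aeval (Sum.elim u x) (MvPolynomial.rename Sum.inl p)
          = MvPolynomial.aeval u p := by
      intro A _ _ u x p
      rw [MvPolynomial.aeval_rename, Sum.elim_comp_inl]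
    have e4 : ∀ (A : Type) [CommRing A] [Algebra k A] (u : Fin m → A) (x : Fin n → A)
        (p : MvPolynomial (Fin n) k),
        MvPolynomial.aeval (Sum.elim u x) (MvPolynomial.rename Sum.inr p)
          = MvPolynomial.aeval x p := by
      intro A _ _ u x p
      rw [MvPolynomial.aeval_rename, Sum.elim_comp_inr]
    obtain ⟨y, hy1, hy2⟩ := transfer_point k L Ω (Fin m ⊕ (Fin n ⊕ Fin n))
      (Sum.elim w (Sum.elim q q'))
      (MvPolynomial.rename a1 (MvPolynomial.rename Sum.inl n0) *
        (MvPolynomial.X (Sum.inr (Sum.inl j)) - MvPolynomial.X (Sum.inr (Sum.inr j)))) (by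
        rw [map_mul, e1, e3]
        refine mul_ne_zero (by rw [Ne, hw0]; exact hn0P) ?_
        simpa [sub_eq_zero] using hj)
    obtain ⟨u, x, x', rfl⟩ : ∃ u x x', y = Sum.elim u (Sum.elim x x') :=
      ⟨y ∘ Sum.inl, (y ∘ Sum.inr) ∘ Sum.inl, (y ∘ Sum.inr) ∘ Sum.inr, by
        rw [Sum.elim_comp_inl_inr, Sum.elim_comp_inl_inr]⟩
    rw [map_mul, e1, e3] at hy1
    have hx : x = x' := by
      refine hc u ?_ ⟨n0, hn0, left_ne_zero_of_mul hy1⟩ x x' ?_ ?_ ?_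
      · intro g hg
        have := hy2 (MvPolynomial.rename a1 (MvPolynomial.rename Sum.inl g))
        rw [e1, e3, e1, e3] at this
        exact this ((hw0 g).2 (hEP g hg))
      · intro j
        have := hy2 (MvPolynomial.rename a1 (f j))
        rw [e1, e1] at this
        exact this (hq j)
      · intro j
        have := hy2 (MvPolynomial.rename a2 (f j))
        rw [e2, e2] at this
        exact this (hq' j)
      · have := hy2 (MvPolynomial.rename a1 (MvPolynomial.rename Sum.inr t) -
          MvPolynomial.rename a2 (MvPolynomial.rename Sum.inr t))
        rw [map_sub, map_sub, e1, e1, e2, e2, e4, e4, e4, e4, sub_eq_zero, sub_eq_zero] at this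
        exact this htt
    apply right_ne_zero_of_mul hy1
    simp [hx]
  -- the generic fibre
  let V : Set (Fin n → Ω) := {q | ∀ j, MvPolynomial.aeval (Sum.elim w q) (f j) = 0}
  have hinj : Set.InjOn (fun q : Fin n → Ω => MvPolynomial.aeval q t) V :=
    fun q hq q' hq' h => hsep q q' hq hq' h
  have hXne : 𝒳.map (MvPolynomial.aeval w : MvPolynomial (Fin m) k →ₐ[k] Ω).toRingHom ≠ 0 := by
    intro h0
    apply hlead
    rw [← hw0]
    have := congrArg (fun p => Polynomial.coeff p 𝒳.natDegree) h0
    simpa using this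
  have hVfin : V.Finite := by
    refine Set.Finite.of_injOn (t := {β | (𝒳.map (MvPolynomial.aeval w :
      MvPolynomial (Fin m) k →ₐ[k] Ω).toRingHom).IsRoot β}) ?_ hinj
      (Polynomial.finite_setOfPred_isRoot hXne)
    intro q hq
    exact hroot q hq
  have hσ : ∀ (σ : Ω ≃ₐ[K] Ω) (s : Type) (x : s → Ω) (F : MvPolynomial s k),
      MvPolynomial.aeval (fun i => σ (x i)) F = σ (MvPolynomial.aeval x F) := by
    intro σ s x F
    exact (MvPolynomial.comp_aeval_apply (f := x) ((σ : Ω →ₐ[K] Ω).restrictScalars k) F).symm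
  have hσV : ∀ (σ : Ω ≃ₐ[K] Ω), ∀ q ∈ V, (fun i => σ (q i)) ∈ V := by
    intro σ q hq j
    have : (Sum.elim w fun i => σ (q i)) = fun i => σ (Sum.elim w q i) := by
      funext i
      rcases i with i | i
      · simp [w]
      · rfl
    rw [this, hσ, hq j, map_zero]
  have hex : ∀ j : Fin n, ∃ (h : MvPolynomial (Fin m) k) (g : Polynomial (MvPolynomial (Fin m) k)),
      h ∉ P ∧ ∀ (u : Fin m → L) (q : Fin n → L), (∀ p ∈ P, MvPolynomial.aeval u p = 0) →
      MvPolynomial.aeval u h ≠ 0 → (∀ j, MvPolynomial.aeval (Sum.elim u q) (f j) = 0) →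
      (g.map (MvPolynomial.aeval u).toRingHom).eval (MvPolynomial.aeval q t) =
        MvPolynomial.aeval u h * q j := by
    intro j
    obtain ⟨p, hp⟩ := galois_interp K Ω V hVfin (fun q => MvPolynomial.aeval q t) hinj hσV
      (fun σ q => hσ σ _ q t) j
    obtain ⟨b, hbm, hbp⟩ := IsLocalization.integerNormalization_spec
      (nonZeroDivisors (MvPolynomial (Fin m) k ⧸ P)) p
    obtain ⟨b, rfl⟩ := Ideal.Quotient.mk_surjective b
    obtain ⟨g, hg⟩ := Polynomial.map_surjective (Ideal.Quotient.mk P)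
      Ideal.Quotient.mk_surjective (IsLocalization.integerNormalization
        (nonZeroDivisors (MvPolynomial (Fin m) k ⧸ P)) p)
    have hbP : b ∉ P := by
      rw [← Ideal.Quotient.eq_zero_iff_mem]
      exact nonZeroDivisors.ne_zero hbm
    have hgv : g.map (MvPolynomial.aeval v : MvPolynomial (Fin m) k →ₐ[k] K).toRingHom
        = Polynomial.C (MvPolynomial.aeval v b) * p := by
      have : (MvPolynomial.aeval v : MvPolynomial (Fin m) k →ₐ[k] K).toRingHom =
          (algebraMap (MvPolynomial (Fin m) k ⧸ P) K).comp (Ideal.Quotient.mk P) :=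
        RingHom.ext (aeval_genPt k P)
      rw [this, ← Polynomial.map_map, hg, hbp, ← Polynomial.smul_eq_C_mul]
      rw [show MvPolynomial.aeval v b = algebraMap (MvPolynomial (Fin m) k ⧸ P) K
        (Ideal.Quotient.mk P b) from aeval_genPt k P b, algebraMap_smul]
    have hgw : g.map (MvPolynomial.aeval w : MvPolynomial (Fin m) k →ₐ[k] Ω).toRingHom
        = Polynomial.C (MvPolynomial.aeval w b) * p.map (algebraMap K Ω) := by
      have : (MvPolynomial.aeval w : MvPolynomial (Fin m) k →ₐ[k] Ω).toRingHom =
          (algebraMap K Ω).comp (MvPolynomial.aeval v : MvPolynomial (Fin m) k →ₐ[k] K).toRingHom :=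
        RingHom.ext hw
      rw [this, ← Polynomial.map_map, hgv, Polynomial.map_mul, Polynomial.map_C, hw]
    let F : MvPolynomial (Fin m ⊕ Fin n) k :=
      toUX g t - MvPolynomial.rename Sum.inl b * MvPolynomial.X (Sum.inr j)
    have hF : ∀ (A : Type) [CommRing A] [Algebra k A] (u : Fin m → A) (q : Fin n → A),
        MvPolynomial.aeval (Sum.elim u q) F = 
        (g.map (MvPolynomial.aeval u : MvPolynomial (Fin m) k →ₐ[k] A).toRingHom).eval
          (MvPolynomial.aeval q t) - MvPolynomial.aeval u b * q j := by
      intro A _ _ u q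
      simp only [F]
      rw [map_sub, map_mul, MvPolynomial.aeval_rename, Sum.elim_comp_inl, aeval_toUX,
        MvPolynomial.aeval_X, Sum.elim_inr]
    obtain ⟨h', hh'P, hh'⟩ := spread k P f F (by
      intro q hq
      refine (hF Ω w q).trans ?_
      rw [hgw, Polynomial.eval_mul, Polynomial.eval_C, Polynomial.eval_map_algebraMap,
        hp q hq, sub_self]) L
    refine ⟨b * h', g * Polynomial.C h', ?_, ?_⟩
    · intro hmem
      rcases Ideal.IsPrime.mem_or_mem ‹P.IsPrime› hmem with h | h
      · exact hbP h
      · exact hh'P h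
    · intro u q hu hne hfq
      rw [map_mul] at hne
      have := hh' u q hu (right_ne_zero_of_mul hne) hfq
      rw [hF, sub_eq_zero] at this
      rw [Polynomial.map_mul, Polynomial.eval_mul, this, Polynomial.map_C, Polynomial.eval_C,
        map_mul]
      change _ * MvPolynomial.aeval u h' = _
      ring
  choose h g hhP hg using hex
  refine ⟨∏ j, h j, ?_, fun j => g j * Polynomial.C (∏ i ∈ Finset.univ.erase j, h i), ?_⟩
  · intro hmem
    obtain ⟨j, _, hj⟩ := (Ideal.IsPrime.prod_mem_iff (hp := ‹P.IsPrime›)).1 hmem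
    exact hhP j hj
  · intro u q hu hne hfq j
    have hprod : (∏ i, h i) = h j * ∏ i ∈ Finset.univ.erase j, h i :=
      (Finset.mul_prod_erase _ _ (Finset.mem_univ j)).symm
    rw [hprod, map_mul] at hne
    rw [hprod, Polynomial.map_mul, Polynomial.eval_mul, Polynomial.map_C, Polynomial.eval_C,
      hg j u q hu (left_ne_zero_of_mul hne) hfq, map_mul]
    change _ * MvPolynomial.aeval u _ = _
    ring

section charpolyRoots

theorem charpoly_root_of_zero (L : Type) [Field L] {n : ℕ} (I : Ideal (MvPolynomial (Fin n) L))
    [FiniteDimensional L (MvPolynomial (Fin n) L ⧸ I)] (T : MvPolynomial (Fin n) L)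
    (q : Fin n → L) (hq : ∀ g ∈ I, MvPolynomial.aeval q g = 0) :
    (LinearMap.charpoly (LinearMap.mulLeft L (Ideal.Quotient.mk I T))).eval
      (MvPolynomial.aeval q T) = 0 := by
  set χ := LinearMap.charpoly (LinearMap.mulLeft L (Ideal.Quotient.mk I T)) with hχ
  have h1 : Polynomial.aeval (LinearMap.mulLeft L (Ideal.Quotient.mk I T)) χ = 0 :=
    LinearMap.aeval_self_charpoly _
  have h2 : Polynomial.aeval (Ideal.Quotient.mk I T) χ = 0 := by
    have h3 : Polynomial.aeval (Algebra.lmul L (MvPolynomial (Fin n) L ⧸ I)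
        (Ideal.Quotient.mk I T)) χ = 0 := h1
    rw [Polynomial.aeval_algHom_apply] at h3
    have := DFunLike.congr_fun h3 1
    simpa using this
  let ψ : (MvPolynomial (Fin n) L ⧸ I) →ₐ[L] L := Ideal.Quotient.liftₐ I (MvPolynomial.aeval q) hq
  have h4 := congrArg ψ h2
  rw [← Polynomial.aeval_algHom_apply, map_zero] at h4
  have h5 : ψ (Ideal.Quotient.mk I T) = MvPolynomial.aeval q T := rfl
  rwa [h5, Polynomial.coe_aeval_eq_eval] at h4

theorem exists_zero_of_charpoly_root (L : Type) [Field L] [IsAlgClosed L] {n : ℕ}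
    (I : Ideal (MvPolynomial (Fin n) L))
    [FiniteDimensional L (MvPolynomial (Fin n) L ⧸ I)] (T : MvPolynomial (Fin n) L)
    (β : L) (hβ : (LinearMap.charpoly (LinearMap.mulLeft L (Ideal.Quotient.mk I T))).eval β = 0) :
    ∃ q : Fin n → L, (∀ g ∈ I, MvPolynomial.aeval q g = 0) ∧ MvPolynomial.aeval q T = β := by
  have hev := (Module.End.hasEigenvalue_iff_isRoot_charpoly
    (LinearMap.mulLeft L (Ideal.Quotient.mk I T)) β).2 hβ
  obtain ⟨x, hx⟩ := hev.exists_hasEigenvector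
  have hx1 : Ideal.Quotient.mk I T * x = β • x := hx.apply_eq_smul
  have hx0 : x ≠ 0 := hx.2
  let J : Ideal (MvPolynomial (Fin n) L) := I ⊔ Ideal.span {T - MvPolynomial.C β}
  have hJ : J ≠ ⊤ := by
    intro h
    rw [Ideal.eq_top_iff_one, Submodule.mem_sup] at h
    obtain ⟨a, ha, b, hb, hab⟩ := h
    obtain ⟨c, rfl⟩ := Ideal.mem_span_singleton'.1 hb
    apply hx0
    have h1 : Ideal.Quotient.mk I (a + c * (T - MvPolynomial.C β)) = 1 := by rw [hab, map_one]
    rw [map_add, Ideal.Quotient.eq_zero_iff_mem.2 ha, zero_add, map_mul, map_sub] at h1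
    have h2 : Ideal.Quotient.mk I (MvPolynomial.C β) * x = β • x := by
      obtain ⟨y, hy⟩ := Ideal.Quotient.mk_surjective x
      rw [← hy, ← map_mul, ← MvPolynomial.smul_eq_C_mul]; rfl
    calc x = 1 * x := (one_mul x).symm
      _ = 0 := by rw [← h1, mul_assoc, sub_mul, hx1, h2, sub_self, mul_zero]
  have : Nontrivial (MvPolynomial (Fin n) L ⧸ J) := Ideal.Quotient.nontrivial_iff.2 hJ
  obtain ⟨ψ⟩ := exists_algHom_of_finiteType L L (MvPolynomial (Fin n) L ⧸ J)
  have hψ : ∀ g, MvPolynomial.aeval (fun i => ψ (Ideal.Quotient.mk J (MvPolynomial.X i))) g =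
      ψ (Ideal.Quotient.mk J g) := by
    intro g
    exact (DFunLike.congr_fun (MvPolynomial.aeval_unique (ψ.comp (Ideal.Quotient.mkₐ L J))) g).symm
  refine ⟨fun i => ψ (Ideal.Quotient.mk J (MvPolynomial.X i)), ?_, ?_⟩
  · intro g hg
    rw [hψ, Ideal.Quotient.eq_zero_iff_mem.2 (Ideal.mem_sup_left hg), map_zero]
  · have h1 : MvPolynomial.aeval (fun i => ψ (Ideal.Quotient.mk J (MvPolynomial.X i)))
        (T - MvPolynomial.C β) = 0 := by
      rw [hψ, Ideal.Quotient.eq_zero_iff_mem.2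
        (show T - MvPolynomial.C β ∈ J from
          Ideal.mem_sup_right (Ideal.mem_span_singleton_self _)), map_zero]
    rw [map_sub, MvPolynomial.aeval_C, sub_eq_zero] at h1
    exact h1

end charpolyRoots

/-- `Z` is a finite union of branches, each carrying polynomials satisfying `Q`. -/
def Covered (k L : Type) [Field k] [Field L] [Algebra k L] {m : ℕ} {D : Type}
    (Q : D → (Fin m → L) → Prop) (Z : Set (Fin m → L)) : Prop :=
  ∃ (ι : Type) (_ : Finite ι) (Es Ns : ι → Finset (MvPolynomial (Fin m) k)) (d : ι → D),
    (∀ u, u ∈ Z ↔ ∃ i, (∀ g ∈ Es i, MvPolynomial.aeval u g = 0) ∧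
      (∃ g ∈ Ns i, MvPolynomial.aeval u g ≠ 0)) ∧
    ∀ i u, (∀ g ∈ Es i, MvPolynomial.aeval u g = 0) →
      (∃ g ∈ Ns i, MvPolynomial.aeval u g ≠ 0) → Q (d i) u

theorem Covered.empty (k L : Type) [Field k] [Field L] [Algebra k L] {m : ℕ} {D : Type}
    (Q : D → (Fin m → L) → Prop) : Covered k L Q ∅ :=
  ⟨Empty, inferInstance, Empty.elim, Empty.elim, Empty.elim, by simp, by simp⟩

theorem Covered.union {k L : Type} [Field k] [Field L] [Algebra k L] {m : ℕ} {D : Type}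
    {Q : D → (Fin m → L) → Prop} {Z W : Set (Fin m → L)} (hZ : Covered k L Q Z)
    (hW : Covered k L Q W) : Covered k L Q (Z ∪ W) := by
  obtain ⟨ι, _, Es, Ns, d, h1, h2⟩ := hZ
  obtain ⟨ι', _, Es', Ns', d', h1', h2'⟩ := hW
  refine ⟨ι ⊕ ι', inferInstance, Sum.elim Es Es', Sum.elim Ns Ns', Sum.elim d d', ?_, ?_⟩
  · intro u
    rw [Set.mem_union, h1, h1', Sum.exists]
    rfl
  · rintro (i | i) u
    · exact h2 i u
    · exact h2' i u

theorem covered_all {k L : Type} [Field k] [Field L] [Algebra k L] {m : ℕ} {D : Type}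
    (Q : D → (Fin m → L) → Prop) (E N : Finset (MvPolynomial (Fin m) k))
    (hgen : ∀ (P : Ideal (MvPolynomial (Fin m) k)), P.IsPrime → (∀ g ∈ E, g ∈ P) →
      (∃ n0 ∈ N, n0 ∉ P) → ∃ h ∉ P, ∃ d : D, ∀ u : Fin m → L,
        (∀ g ∈ E, MvPolynomial.aeval u g = 0) → (∃ g ∈ N, MvPolynomial.aeval u g ≠ 0) →
        (∀ p ∈ P, MvPolynomial.aeval u p = 0) → MvPolynomial.aeval u h ≠ 0 → Q d u)
    (J : Ideal (MvPolynomial (Fin m) k)) :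
    Covered k L Q {u | (∀ p ∈ J, MvPolynomial.aeval u p = 0) ∧
      (∀ g ∈ E, MvPolynomial.aeval u g = 0) ∧ (∃ g ∈ N, MvPolynomial.aeval u g ≠ 0)} := by
  classical
  induction J using WellFoundedGT.induction with
  | _ J ih =>
  have hlt : ∀ a ∉ J, J < J ⊔ Ideal.span {a} := by
    intro a ha
    refine lt_of_le_of_ne le_sup_left fun h => ha ?_
    rw [h]
    exact Ideal.mem_sup_right (Ideal.subset_span rfl)
  have hsup : ∀ (a : MvPolynomial (Fin m) k) (u : Fin m → L),
      (∀ p ∈ J ⊔ Ideal.span {a}, MvPolynomial.aeval u p = 0) ↔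
      (∀ p ∈ J, MvPolynomial.aeval u p = 0) ∧ MvPolynomial.aeval u a = 0 := by
    intro a u
    have : ∀ J' : Ideal (MvPolynomial (Fin m) k), (∀ p ∈ J', MvPolynomial.aeval u p = 0) ↔
      J' ≤ RingHom.ker (MvPolynomial.aeval u : MvPolynomial (Fin m) k →ₐ[k] L) := fun _ => Iff.rfl
    rw [this, this, sup_le_iff, Ideal.span_singleton_le_iff_mem]
    rfl
  by_cases hE : ∀ g ∈ E, g ∈ J
  swap
  · push Not at hE
    obtain ⟨g, hgE, hgJ⟩ := hE
    convert ih _ (hlt g hgJ) using 1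
    ext u
    simp only [Set.mem_ofPred_eq, hsup]
    constructor
    · rintro ⟨h1, h2, h3⟩
      exact ⟨⟨h1, h2 g hgE⟩, h2, h3⟩
    · rintro ⟨⟨h1, _⟩, h2, h3⟩
      exact ⟨h1, h2, h3⟩
  by_cases hN : ∃ n0 ∈ N, n0 ∉ J
  swap
  · push Not at hN
    convert Covered.empty k L Q using 1
    ext u
    simp only [Set.mem_ofPred_eq, Set.mem_empty_iff_false, iff_false]
    rintro ⟨h1, _, g, hg, h3⟩
    exact h3 (h1 g (hN g hg))
  by_cases hJ : J.IsPrime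
  · obtain ⟨h, hhJ, d, hd⟩ := hgen J hJ hE hN
    obtain ⟨B, hB⟩ := (IsNoetherian.noetherian J : J.FG)
    have hBJ : ∀ u : Fin m → L, (∀ p ∈ B, MvPolynomial.aeval u p = 0) ↔
        ∀ p ∈ J, MvPolynomial.aeval u p = 0 := by
      intro u
      constructor
      · intro h1
        have : J ≤ RingHom.ker (MvPolynomial.aeval u : MvPolynomial (Fin m) k →ₐ[k] L) := by
          rw [← hB]
          exact Ideal.span_le.2 h1
        exact this
      · intro h1 p hp
        exact h1 p (hB ▸ Ideal.subset_span hp)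
    have key : ∀ u : Fin m → L, ((∀ g ∈ B ∪ E, MvPolynomial.aeval u g = 0) ∧
        (∃ g ∈ N.image (fun x => h * x), MvPolynomial.aeval u g ≠ 0)) ↔
        (∀ p ∈ J, MvPolynomial.aeval u p = 0) ∧ (∀ g ∈ E, MvPolynomial.aeval u g = 0) ∧
        (∃ g ∈ N, MvPolynomial.aeval u g ≠ 0) ∧ MvPolynomial.aeval u h ≠ 0 := by
      intro u
      rw [← hBJ]
      constructor
      · rintro ⟨h1, g, hg, h2⟩
        obtain ⟨x, hx, rfl⟩ := Finset.mem_image.1 hg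
        rw [map_mul] at h2
        exact ⟨fun p hp => h1 p (Finset.mem_union_left _ hp),
          fun p hp => h1 p (Finset.mem_union_right _ hp), ⟨x, hx, right_ne_zero_of_mul h2⟩,
          left_ne_zero_of_mul h2⟩
      · rintro ⟨h1, h2, ⟨x, hx, h3⟩, h4⟩
        refine ⟨fun g hg => (Finset.mem_union.1 hg).elim (h1 g) (h2 g), h * x,
          Finset.mem_image_of_mem _ hx, ?_⟩
        rw [map_mul]
        exact mul_ne_zero h4 h3
    have c1 : Covered k L Q {u | (∀ p ∈ J, MvPolynomial.aeval u p = 0) ∧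
        (∀ g ∈ E, MvPolynomial.aeval u g = 0) ∧
        (∃ g ∈ N, MvPolynomial.aeval u g ≠ 0) ∧ MvPolynomial.aeval u h ≠ 0} := by
      refine ⟨Unit, inferInstance, fun _ => B ∪ E, fun _ => N.image (fun x => h * x),
        fun _ => d, ?_, ?_⟩
      · intro u
        rw [Set.mem_ofPred_eq, ← key]
        simp
      · intro _ u h1 h2
        obtain ⟨h3, h4, h5, h6⟩ := (key u).1 ⟨h1, h2⟩
        exact hd u h4 h5 h3 h6
    convert c1.union (ih _ (hlt h hhJ)) using 1
    ext u
    simp only [Set.mem_ofPred_eq, Set.mem_union, hsup]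
    constructor
    · rintro ⟨h1, h2, h3⟩
      by_cases h4 : MvPolynomial.aeval u h = 0
      · exact Or.inr ⟨⟨h1, h4⟩, h2, h3⟩
      · exact Or.inl ⟨h1, h2, h3, h4⟩
    · rintro (⟨h1, h2, h3, _⟩ | ⟨⟨h1, _⟩, h2, h3⟩)
      · exact ⟨h1, h2, h3⟩
      · exact ⟨h1, h2, h3⟩
  · by_cases htop : J = ⊤
    · exfalso
      obtain ⟨n0, _, h⟩ := hN
      exact h (htop ▸ Submodule.mem_top)
    have : ∃ x y, x * y ∈ J ∧ x ∉ J ∧ y ∉ J := by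
      by_contra hcon
      push Not at hcon
      refine hJ (Ideal.isPrime_iff.2 ⟨htop, fun {x y} hxy => ?_⟩)
      by_contra hn
      push Not at hn
      exact hn.2 (hcon x y hxy hn.1)
    obtain ⟨x, y, hxy, hx, hy⟩ := this
    convert (ih _ (hlt x hx)).union (ih _ (hlt y hy)) using 1
    ext u
    simp only [Set.mem_ofPred_eq, Set.mem_union, hsup]
    constructor
    · rintro ⟨h1, h2⟩
      have := h1 _ hxy
      rw [map_mul, mul_eq_zero] at this
      exact this.imp (fun h => ⟨⟨h1, h⟩, h2⟩) (fun h => ⟨⟨h1, h⟩, h2⟩)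
    · rintro (⟨⟨h1, _⟩, h2⟩ | ⟨⟨h1, _⟩, h2⟩)
      · exact ⟨h1, h2⟩
      · exact ⟨h1, h2⟩

/-- parametric RUR: suppose that on `V_L(E)∖V_L(N)` every `I(u)` is
zero-dimensional and `t` separates `V_L(I(u))`, and `𝒳 ∈ k[U][T]` has leading coefficient
nonvanishing on `V_L(E)∖V_L(N)` and specializes at each such `u` to a nonzero scalar
multiple of the characteristic polynomial of multiplication by `t` on `L[X]/I(u)`.  Then
`V_L(E)∖V_L(N)` is covered by finitely many branches `V_L(E_i)∖V_L(N_i)` carrying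
polynomials `g_i, g_{i1},…,g_{in} ∈ k[U][T]` such that on each branch, `g_i(u,β) ≠ 0` for
every root `β` of `𝒳(u,T)` and
`V_L(I(u)) = {(g_{i1}(u,β)/g_i(u,β),…,g_{in}(u,β)/g_i(u,β)) : 𝒳(u,β) = 0}`. -/
theorem stmt_13 (k L : Type) [Field k] [CharZero k] [Field L] [Algebra k L]
    [IsAlgClosure k L] (m n l : ℕ) (f : Fin l → MvPolynomial (Fin m ⊕ Fin n) k)
    (t : MvPolynomial (Fin n) k)
    (E N : Finset (MvPolynomial (Fin m) k))
    (hfin : ∀ u : Fin m → L,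
      (∀ g ∈ E, MvPolynomial.aeval u g = 0) → (∃ g ∈ N, MvPolynomial.aeval u g ≠ 0) →
      FiniteDimensional L (MvPolynomial (Fin n) L ⧸ specIdeal k L f u))
    (hsep : ∀ u : Fin m → L,
      (∀ g ∈ E, MvPolynomial.aeval u g = 0) → (∃ g ∈ N, MvPolynomial.aeval u g ≠ 0) →
      Set.InjOn (fun q : Fin n → L => MvPolynomial.aeval q t)
        {q : Fin n → L | ∀ g ∈ specIdeal k L f u, MvPolynomial.aeval q g = 0})
    (𝒳 : Polynomial (MvPolynomial (Fin m) k))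
    (hlead : ∀ u : Fin m → L,
      (∀ g ∈ E, MvPolynomial.aeval u g = 0) → (∃ g ∈ N, MvPolynomial.aeval u g ≠ 0) →
      MvPolynomial.aeval u 𝒳.leadingCoeff ≠ 0)
    (hchar : ∀ (u : Fin m → L)
      (hE : ∀ g ∈ E, MvPolynomial.aeval u g = 0) (hN : ∃ g ∈ N, MvPolynomial.aeval u g ≠ 0),
      ∃ c : L, c ≠ 0 ∧
        𝒳.map (MvPolynomial.aeval u).toRingHom
          = c • (letI := hfin u hE hN;
              LinearMap.charpoly (LinearMap.mulLeft L
                ((Ideal.Quotient.mk (specIdeal k L f u))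
                  (MvPolynomial.map (algebraMap k L) t))))) :
    ∃ (s : ℕ) (Es Ns : Fin s → Finset (MvPolynomial (Fin m) k))
      (G : Fin s → Polynomial (MvPolynomial (Fin m) k))
      (Gs : Fin s → Fin n → Polynomial (MvPolynomial (Fin m) k)),
      (∀ u : Fin m → L,
        ((∀ g ∈ E, MvPolynomial.aeval u g = 0) ∧ (∃ g ∈ N, MvPolynomial.aeval u g ≠ 0))
          ↔ ∃ i : Fin s, (∀ g ∈ Es i, MvPolynomial.aeval u g = 0) ∧
              (∃ g ∈ Ns i, MvPolynomial.aeval u g ≠ 0)) ∧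
      (∀ (i : Fin s) (u : Fin m → L),
        (∀ g ∈ Es i, MvPolynomial.aeval u g = 0) → (∃ g ∈ Ns i, MvPolynomial.aeval u g ≠ 0) →
        (∀ β : L, (𝒳.map (MvPolynomial.aeval u).toRingHom).eval β = 0 →
            ((G i).map (MvPolynomial.aeval u).toRingHom).eval β ≠ 0) ∧
          {q : Fin n → L | ∀ g ∈ specIdeal k L f u, MvPolynomial.aeval q g = 0}
            = (fun β : L => fun j : Fin n =>
                  ((Gs i j).map (MvPolynomial.aeval u).toRingHom).eval β /
                    ((G i).map (MvPolynomial.aeval u).toRingHom).eval β) ''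
                {β : L | (𝒳.map (MvPolynomial.aeval u).toRingHom).eval β = 0}) := by
  have hLac : IsAlgClosed L := IsAlgClosure.isAlgClosed k
  have hmap : ∀ q : Fin n → L, MvPolynomial.aeval q (MvPolynomial.map (algebraMap k L) t) =
      MvPolynomial.aeval q t := fun q => MvPolynomial.aeval_map_algebraMap L q t
  have hb : ∀ u : Fin m → L,
      (∀ g ∈ E, MvPolynomial.aeval u g = 0) → (∃ g ∈ N, MvPolynomial.aeval u g ≠ 0) →
      ∀ q : Fin n → L, (∀ j, MvPolynomial.aeval (Sum.elim u q) (f j) = 0) →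
      (𝒳.map (MvPolynomial.aeval u).toRingHom).eval (MvPolynomial.aeval q t) = 0 := by
    intro u hE hN q hq
    obtain ⟨c, _, hc⟩ := hchar u hE hN
    have := hfin u hE hN
    rw [hc, Polynomial.eval_smul, ← hmap,
      charpoly_root_of_zero L (specIdeal k L f u) _ q ((mem_spec_iff k L f u q).2 hq), smul_zero]
  have hd : ∀ u : Fin m → L,
      (∀ g ∈ E, MvPolynomial.aeval u g = 0) → (∃ g ∈ N, MvPolynomial.aeval u g ≠ 0) →
      ∀ β : L, (𝒳.map (MvPolynomial.aeval u).toRingHom).eval β = 0 →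
      ∃ q : Fin n → L, (∀ j, MvPolynomial.aeval (Sum.elim u q) (f j) = 0) ∧
        MvPolynomial.aeval q t = β := by
    intro u hE hN β hβ
    obtain ⟨c, hc0, hc⟩ := hchar u hE hN
    have := hfin u hE hN
    rw [hc, Polynomial.eval_smul, smul_eq_mul] at hβ
    obtain ⟨q, hq1, hq2⟩ := exists_zero_of_charpoly_root L (specIdeal k L f u) _ β
      ((mul_eq_zero.1 hβ).resolve_left hc0)
    exact ⟨q, (mem_spec_iff k L f u q).1 hq1, by rw [← hmap, hq2]⟩
  have hc : ∀ u : Fin m → L,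
      (∀ g ∈ E, MvPolynomial.aeval u g = 0) → (∃ g ∈ N, MvPolynomial.aeval u g ≠ 0) →
      ∀ q q' : Fin n → L, (∀ j, MvPolynomial.aeval (Sum.elim u q) (f j) = 0) →
      (∀ j, MvPolynomial.aeval (Sum.elim u q') (f j) = 0) →
      MvPolynomial.aeval q t = MvPolynomial.aeval q' t → q = q' := by
    intro u hE hN q q' hq hq' h
    exact hsep u hE hN ((mem_spec_iff k L f u q).2 hq) ((mem_spec_iff k L f u q').2 hq') h
  let Q : Polynomial (MvPolynomial (Fin m) k) × (Fin n → Polynomial (MvPolynomial (Fin m) k)) →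
      (Fin m → L) → Prop := fun d u =>
    (∀ β : L, (𝒳.map (MvPolynomial.aeval u).toRingHom).eval β = 0 →
            (d.1.map (MvPolynomial.aeval u).toRingHom).eval β ≠ 0) ∧
          {q : Fin n → L | ∀ g ∈ specIdeal k L f u, MvPolynomial.aeval q g = 0}
            = (fun β : L => fun j : Fin n =>
                  ((d.2 j).map (MvPolynomial.aeval u).toRingHom).eval β /
                    (d.1.map (MvPolynomial.aeval u).toRingHom).eval β) ''
                {β : L | (𝒳.map (MvPolynomial.aeval u).toRingHom).eval β = 0}
  have hcov := covered_all (L := L) Q E N (by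
    intro P hP hEP hNP
    obtain ⟨n0, hn0, hn0P⟩ := hNP
    obtain ⟨h, hhP, g, hg⟩ := generic_step k L m n l f t E N 𝒳 hlead hb hc P hEP n0 hn0 hn0P
    refine ⟨h, hhP, (Polynomial.C h, g), ?_⟩
    intro u hE hN hu hhu
    have hC : ∀ β : L, ((Polynomial.C h).map
        (MvPolynomial.aeval u : MvPolynomial (Fin m) k →ₐ[k] L).toRingHom).eval β
        = MvPolynomial.aeval u h := by
      intro β
      rw [Polynomial.map_C, Polynomial.eval_C]
      rfl
    have hpt : ∀ q : Fin n → L, (∀ j, MvPolynomial.aeval (Sum.elim u q) (f j) = 0) →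
        (fun j : Fin n => ((g j).map (MvPolynomial.aeval u).toRingHom).eval
          (MvPolynomial.aeval q t) / ((Polynomial.C h).map
          (MvPolynomial.aeval u).toRingHom).eval (MvPolynomial.aeval q t)) = q := by
      intro q hq
      funext j
      rw [hC, hg u q hu hhu hq j, mul_div_cancel_left₀ _ hhu]
    refine ⟨fun β _ => by rw [hC]; exact hhu, ?_⟩
    ext q
    constructor
    · intro hq
      have hq' := (mem_spec_iff k L f u q).1 hq
      exact ⟨MvPolynomial.aeval q t, hb u hE hN q hq', hpt q hq'⟩
    · rintro ⟨β, hβ, rfl⟩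
      obtain ⟨q, hq, rfl⟩ := hd u hE hN β hβ
      have := hpt q hq
      dsimp only at this ⊢
      rw [this]
      exact (mem_spec_iff k L f u q).2 hq) ⊥
  obtain ⟨ι, _, Es, Ns, d, h1, h2⟩ := hcov
  let e := (Finite.equivFin ι).symm
  refine ⟨Nat.card ι, Es ∘ e, Ns ∘ e, fun i => (d (e i)).1, fun i => (d (e i)).2, ?_, ?_⟩
  · intro u
    have := h1 u
    rw [e.surjective.exists] at this
    refine Iff.trans ?_ this
    constructor
    · intro h
      refine ⟨?_, h⟩
      intro p hp
      rw [(Submodule.mem_bot _).1 hp, map_zero]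
    · exact fun h => h.2
  · intro i u hE hN
    exact h2 (e i) u hE hN
end
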